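/- arXiv:math/0603727 — 6 statements merged into one kernel-verified Lean document; each statement's English description precedes it below -/
import Mathlib

section
/- Let V be a finite set with |V| = n and let A be an n×n matrix with nonnegative integer entries, indexed by V, such that every row sum and every column sum of A equals k (i.e., A is the adjacency matrix of a directed multigraph on V in which every vertex has in-degree and out-degree k, where (Af)(v) = Σ_{v→w} f(w)). Suppose there is a constant μ with 0 < μ < k such that ‖Af‖ ≤ μ‖f‖ for every f ∈ L²(V) with f ⊥ 𝟙 (i.e., Σ_{v∈V} f(v) = 0), where ‖·‖ is the Euclidean norm on functions V → ℝ. Then for every subset S ⊆ V, every vertex y ∈ V, and every natural number r ≥ log(2n)/log(k/μ), the number of directed paths of length r starting at y and ending in S (equivalently, Σ_{s∈S} (Aᵀ)^r applied appropriately, i.e., the inner product ⟨χ_S, A^r χ_{{y}}⟩) lies between (1/2)·k^r·|S|/n and (3/2)·k^r·|S|/n. -/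
open Finset

/-- If all column sums of `B` are equal to `c`, then `B` multiplies the sum of entries by `c`. -/
theorem sum_mulVec_of_col_sum {V : Type*} [Fintype V] {B : Matrix V V ℝ} {c : ℝ}
    (hcol : ∀ w, ∑ v, B v w = c) (f : V → ℝ) :
    ∑ v, B.mulVec f v = c * ∑ v, f v := by
  simp only [Matrix.mulVec, dotProduct]
  rw [Finset.sum_comm, Finset.mul_sum]
  exact Finset.sum_congr rfl fun w _ => by rw [← Finset.sum_mul, hcol]

/-- If all row sums of `B` are equal to `c`, then `B ^ r` maps the constant vector `a` to the
constant vector `c ^ r * a`. -/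
theorem pow_mulVec_const_of_row_sum {V : Type*} [Fintype V] [DecidableEq V] {B : Matrix V V ℝ}
    {c : ℝ} (hrow : ∀ v, ∑ w, B v w = c) (a : ℝ) (r : ℕ) :
    (B ^ r).mulVec (fun _ => a) = fun _ => c ^ r * a := by
  induction r with
  | zero => simp
  | succ r ih =>
    rw [pow_succ', ← Matrix.mulVec_mulVec, ih]
    funext v
    simp only [Matrix.mulVec, dotProduct]
    rw [← Finset.sum_mul, hrow]
    ring

/-- A contraction estimate for `B` on the vectors of sum zero iterates. -/
theorem sqrt_sum_sq_pow_mulVec_le {V : Type*} [Fintype V] [DecidableEq V] {B : Matrix V V ℝ}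
    {c μ : ℝ} (hμ : 0 ≤ μ) (hcol : ∀ w, ∑ v, B v w = c)
    (hop : ∀ f : V → ℝ, ∑ v, f v = 0 →
      √(∑ v, (B.mulVec f v) ^ 2) ≤ μ * √(∑ v, (f v) ^ 2))
    {f : V → ℝ} (hf : ∑ v, f v = 0) (r : ℕ) :
    ∑ v, (B ^ r).mulVec f v = 0 ∧
      √(∑ v, ((B ^ r).mulVec f v) ^ 2) ≤ μ ^ r * √(∑ v, (f v) ^ 2) := by
  induction r with
  | zero => simp [hf]
  | succ r ih =>
    rw [pow_succ', ← Matrix.mulVec_mulVec]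
    refine ⟨by rw [sum_mulVec_of_col_sum hcol, ih.1, mul_zero], (hop _ ih.1).trans ?_⟩
    rw [pow_succ', mul_assoc]
    exact mul_le_mul_of_nonneg_left ih.2 hμ

/-- Cauchy–Schwarz for the sum of a function over a subset. -/
theorem abs_sum_le_sqrt_card_mul_sqrt_sum_sq {V : Type*} [Fintype V] (S : Finset V)
    (g : V → ℝ) : |∑ s ∈ S, g s| ≤ √S.card * √(∑ v, (g v) ^ 2) := by
  rw [← Real.sqrt_mul (Nat.cast_nonneg _)]
  refine Real.abs_le_sqrt (sq_sum_le_card_mul_sum_sq.trans ?_)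
  gcongr
  exact Finset.subset_univ S

/-- The projection of a point mass to the vectors of sum zero. -/
theorem sum_single_sub_inv_card {V : Type*} [Fintype V] [DecidableEq V] (y : V) :
    ∑ v, (Pi.single y 1 - fun _ => (Fintype.card V : ℝ)⁻¹ : V → ℝ) v = 0 := by
  have : Nonempty V := ⟨y⟩
  simp

/-- The projection of a point mass to the vectors of sum zero has norm at most one. -/
theorem sqrt_sum_sq_single_sub_inv_card_le_one {V : Type*} [Fintype V] [DecidableEq V] (y : V) :
    √(∑ v, ((Pi.single y 1 - fun _ => (Fintype.card V : ℝ)⁻¹ : V → ℝ) v) ^ 2) ≤ 1 := by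
  have : Nonempty V := ⟨y⟩
  have hn : (0 : ℝ) < Fintype.card V := by exact_mod_cast Fintype.card_pos
  rw [Real.sqrt_le_one]
  have h (v : V) : ((Pi.single y 1 - fun _ => (Fintype.card V : ℝ)⁻¹ : V → ℝ) v) ^ 2 =
      (1 - 2 * (Fintype.card V : ℝ)⁻¹) * (Pi.single y (1 : ℝ) : V → ℝ) v +
        (Fintype.card V : ℝ)⁻¹ ^ 2 := by
    by_cases hv : v = y
    · subst hv
      simp
      ring
    · simp [hv]
  simp only [h, Finset.sum_add_distrib, ← Finset.mul_sum, Finset.sum_const, Finset.card_univ,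
    nsmul_eq_mul, Fintype.sum_pi_single']
  have := inv_pos.2 hn
  have h2 : (Fintype.card V : ℝ) * (Fintype.card V : ℝ)⁻¹ ^ 2 = (Fintype.card V : ℝ)⁻¹ := by
    field_simp
  rw [h2]
  linarith

/-- **Rapid mixing lemma for directed regular multigraphs.**
If `A` is the adjacency matrix of a directed `k`-regular multigraph on `n` vertices
whose restriction to the orthogonal complement of the constants has operator norm
at most `μ < k`, then for `r ≥ log(2n)/log(k/μ)` the number of directed paths of
length `r` from any vertex `y` ending in a set `S` (i.e. `⟨χ_S, A^r χ_{y}⟩`)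
lies between `(1/2)·k^r·|S|/n` and `(3/2)·k^r·|S|/n`. -/
theorem pollard_rho_mixing_lemma
    (V : Type*) [Fintype V] [DecidableEq V] (n k : ℕ)
    (hcard : Fintype.card V = n)
    (A : Matrix V V ℕ)
    (hrow : ∀ v : V, ∑ w : V, A v w = k)
    (hcol : ∀ w : V, ∑ v : V, A v w = k)
    (μ : ℝ) (hμ0 : 0 < μ) (hμk : μ < k)
    (hop : ∀ f : V → ℝ, (∑ v : V, f v) = 0 →
      Real.sqrt (∑ v : V, ((A.map (Nat.cast : ℕ → ℝ)).mulVec f v) ^ 2)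
        ≤ μ * Real.sqrt (∑ v : V, (f v) ^ 2))
    (S : Finset V) (y : V) (r : ℕ)
    (hr : Real.log (2 * n) / Real.log (k / μ) ≤ (r : ℝ)) :
    (1 / 2 : ℝ) * k ^ r * S.card / n ≤ (∑ s ∈ S, ((A ^ r) s y : ℝ)) ∧
      (∑ s ∈ S, ((A ^ r) s y : ℝ)) ≤ (3 / 2 : ℝ) * k ^ r * S.card / n := by
  subst hcard
  have : Nonempty V := ⟨y⟩
  have hn : (0 : ℝ) < Fintype.card V := by exact_mod_cast Fintype.card_pos
  set n : ℝ := (Fintype.card V : ℝ)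
  set B : Matrix V V ℝ := A.map (Nat.cast : ℕ → ℝ) with hB
  have hk : (0 : ℝ) < k := hμ0.trans hμk
  have hrow' (v : V) : ∑ w, B v w = k := by
    simp only [hB, Matrix.map_apply]
    exact_mod_cast hrow v
  have hcol' (w : V) : ∑ v, B v w = k := by
    simp only [hB, Matrix.map_apply]
    exact_mod_cast hcol w
  have hdecay : 2 * n * μ ^ r ≤ (k : ℝ) ^ r := by
    have h1 : 1 < (k : ℝ) / μ := (one_lt_div hμ0).2 hμk
    rw [div_le_iff₀ (Real.log_pos h1), ← Real.log_pow,
      Real.log_le_log_iff (by positivity) (by positivity), div_pow,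
      le_div_iff₀ (by positivity)] at hr
    exact hr
  set f : V → ℝ := Pi.single y (1 : ℝ) - fun _ => n⁻¹ with hf
  have hnorm := (sqrt_sum_sq_pow_mulVec_le hμ0.le hcol' hop (sum_single_sub_inv_card y) r).2
  have hpow (s : V) : ((A ^ r) s y : ℝ) = (B ^ r).mulVec f s + k ^ r * n⁻¹ := by
    have hBr : B ^ r = (A ^ r).map (Nat.cast : ℕ → ℝ) :=
      (map_pow (Nat.castRingHom ℝ).mapMatrix A r).symm
    rw [hf, Matrix.mulVec_sub, Pi.sub_apply, pow_mulVec_const_of_row_sum hrow', sub_add_cancel,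
      Matrix.mulVec_single_one, hBr]
    rfl
  have hsum : ∑ s ∈ S, ((A ^ r) s y : ℝ) = ∑ s ∈ S, (B ^ r).mulVec f s + k ^ r * S.card / n := by
    simp only [hpow, Finset.sum_add_distrib, Finset.sum_const, nsmul_eq_mul]
    ring
  have hsqrt : √(S.card : ℝ) ≤ S.card := by
    refine Real.sqrt_le_iff.2 ⟨Nat.cast_nonneg _, ?_⟩
    exact_mod_cast Nat.le_self_pow two_ne_zero S.card
  have herr : |∑ s ∈ S, (B ^ r).mulVec f s| ≤ 1 / 2 * (k ^ r * S.card / n) := by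
    calc |∑ s ∈ S, (B ^ r).mulVec f s|
        ≤ √S.card * √(∑ v, ((B ^ r).mulVec f v) ^ 2) := abs_sum_le_sqrt_card_mul_sqrt_sum_sq S _
      _ ≤ S.card * (μ ^ r * 1) := by
          gcongr
          exact hnorm.trans (mul_le_mul_of_nonneg_left
            (sqrt_sum_sq_single_sub_inv_card_le_one y) (by positivity))
      _ ≤ S.card * (k ^ r / (2 * n)) := by
          gcongr
          rw [mul_one, le_div_iff₀ (by positivity)]
          linarith
      _ = 1 / 2 * (k ^ r * S.card / n) := by
          field_simp
  have key := abs_le.1 herr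
  have e (c : ℝ) : c * k ^ r * S.card / n = c * (k ^ r * S.card / n) := by ring
  rw [hsum, e, e]
  constructor <;> linarith [key.1, key.2]
end

section
/- There exists an absolute constant c > 0 with the following property. Let n ≥ 3 be an odd integer, and for k ∈ ℤ/nℤ set λ_k = |cos(π k̃ / n)|, where k̃ is any integer representative of k (this is well-defined). Define the quadratic form Q on real tuples (x_k)_{k ∈ ℤ/nℤ, k ≠ 0} by Q(x) = Σ_{k ≠ 0} x_k · x_{2k} · λ_k, where the subscript 2k is computed in ℤ/nℤ. Then for all such tuples, |Q(x)| ≤ (1 − c/(log n)²) · Σ_{k ≠ 0} x_k². -/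
open Finset Real

/-- Distance from `k` to `0` in the cycle `ℤ/nℤ`. -/
def cycleDist {n : ℕ} (k : ZMod n) : ℕ := min k.val (n - k.val)

lemma cycleDist_pos {n : ℕ} [NeZero n] {k : ZMod n} (hk : k ≠ 0) : 0 < cycleDist k := by
  have h1 := ZMod.val_lt k
  have h2 : k.val ≠ 0 := by simpa using hk
  unfold cycleDist
  omega

lemma cycleDist_le {n : ℕ} (k : ZMod n) : cycleDist k ≤ n := by
  unfold cycleDist
  omega

lemma cycleDist_two_mul {n : ℕ} [NeZero n] {k : ZMod n} (hk : 4 * cycleDist k < n) :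
    cycleDist (2 * k) = 2 * cycleDist k := by
  have h1 := ZMod.val_lt k
  have h2 : (2 * k).val = (2 * k.val) % n := by
    rw [two_mul, ZMod.val_add, two_mul]
  unfold cycleDist at *
  rw [h2]
  rcases lt_or_ge (2 * k.val) n with h | h
  · rw [Nat.mod_eq_of_lt h]
    omega
  · rw [Nat.mod_eq_sub_mod h, Nat.mod_eq_of_lt (by omega)]
    omega

lemma cos_sq_le_half {n : ℕ} [NeZero n] {k : ZMod n} (hk : n ≤ 4 * cycleDist k) :
    Real.cos (π * k.val / n) ^ 2 ≤ 1 / 2 := by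
  have h1 := ZMod.val_lt k
  have hn : (0 : ℝ) < n := by exact_mod_cast Nat.pos_of_ne_zero (NeZero.ne n)
  have h2 : (n : ℝ) ≤ 4 * k.val := by
    unfold cycleDist at hk
    exact_mod_cast (by omega : n ≤ 4 * k.val)
  have h3 : 4 * (k.val : ℝ) ≤ 3 * n := by
    unfold cycleDist at hk
    exact_mod_cast (by omega : 4 * k.val ≤ 3 * n)
  have h4 : Real.cos (2 * (π * k.val / n)) ≤ 0 := by
    apply Real.cos_nonpos_of_pi_div_two_le_of_le
    · rw [← mul_div_assoc, le_div_iff₀ hn]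
      nlinarith [Real.pi_pos]
    · rw [← mul_div_assoc, div_le_iff₀ hn]
      nlinarith [Real.pi_pos]
  rw [Real.cos_sq]
  linarith

/-- A concave, slowly varying weight on the levels `0, …, L`. -/
def levelWeight (L j : ℕ) : ℝ := 9 * (L : ℝ) ^ 2 - (j : ℝ) ^ 2

lemma levelWeight_ge {L j : ℕ} (hj : j ≤ L) : 8 * (L : ℝ) ^ 2 ≤ levelWeight L j := by
  have : (j : ℝ) ≤ L := by exact_mod_cast hj
  have : (0 : ℝ) ≤ j := j.cast_nonneg
  unfold levelWeight
  nlinarith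

lemma levelWeight_pos {L j : ℕ} (hL : 1 ≤ L) (hj : j ≤ L) : 0 < levelWeight L j := by
  have : (1 : ℝ) ≤ L := by exact_mod_cast hL
  have := levelWeight_ge hj
  nlinarith

lemma levelWeight_div_succ_le {L j : ℕ} (hL : 1 ≤ L) (hj : j + 1 ≤ L) :
    levelWeight L j / levelWeight L (j + 1) ≤ 5 / 4 := by
  have h1 : (1 : ℝ) ≤ L := by exact_mod_cast hL
  have h2 : (j : ℝ) + 1 ≤ L := by exact_mod_cast hj
  have h3 := levelWeight_ge hj
  rw [div_le_iff₀ (levelWeight_pos hL hj)]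
  have h4 : levelWeight L j = levelWeight L (j + 1) + (2 * j + 1) := by
    unfold levelWeight
    push_cast
    ring
  nlinarith

lemma levelWeight_succ_div_le {L j : ℕ} (hL : 1 ≤ L) (hj : j ≤ L) :
    levelWeight L (j + 1) / levelWeight L j ≤ 1 := by
  rw [div_le_one (levelWeight_pos hL hj)]
  unfold levelWeight
  push_cast
  nlinarith [(j.cast_nonneg : (0 : ℝ) ≤ j)]

lemma levelWeight_div_add_div_le {L j : ℕ} (hL : 1 ≤ L) (hj : j + 1 ≤ L) :
    levelWeight L (j + 2) / levelWeight L (j + 1) + levelWeight L j / levelWeight L (j + 1)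
      ≤ 2 * (1 - 1 / (100 * (L : ℝ) ^ 2)) := by
  have h1 : (1 : ℝ) ≤ L := by exact_mod_cast hL
  have hw := levelWeight_pos hL hj
  have hw' : levelWeight L (j + 1) ≤ 100 * (L : ℝ) ^ 2 := by
    unfold levelWeight
    nlinarith [sq_nonneg (((j + 1 : ℕ) : ℝ))]
  have h2 : levelWeight L (j + 2) + levelWeight L j = 2 * levelWeight L (j + 1) - 2 := by
    unfold levelWeight
    push_cast
    ring
  rw [← add_div, h2, sub_div, mul_div_assoc, div_self hw.ne']
  have h3 := one_div_le_one_div_of_le hw hw'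
  have h4 : 2 / levelWeight L (j + 1) = 2 * (1 / levelWeight L (j + 1)) := by ring
  rw [h4]
  linarith

lemma two_mul_abs_mul_mul_le {a b l p q : ℝ} (hp : 0 ≤ p) (hq : 0 ≤ q) (h : l ^ 2 ≤ p * q) :
    2 * |a * b * l| ≤ p * a ^ 2 + q * b ^ 2 := by
  have h0 : 0 ≤ p * a ^ 2 + q * b ^ 2 := by positivity
  have h1 : (2 * (a * b * l)) ^ 2 ≤ (p * a ^ 2 + q * b ^ 2) ^ 2 := by
    nlinarith [sq_nonneg (p * a ^ 2 - q * b ^ 2), mul_le_mul_of_nonneg_left h (sq_nonneg (a * b))]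
  have h2 := abs_le_of_sq_le_sq h1 h0
  rwa [abs_mul, abs_two] at h2

/-- The Schur test for a form `∑ x_k x_{e k} l_k` supported on an `e`-invariant set. -/
lemma abs_sum_mul_comp_le {ι : Type*} (s : Finset ι) (e : ι ≃ ι) (he : ∀ i, e i ∈ s ↔ i ∈ s)
    (x l p q : ι → ℝ) (r : ℝ) (hp : ∀ i ∈ s, 0 ≤ p i) (hq : ∀ i ∈ s, 0 ≤ q i)
    (hl : ∀ i ∈ s, l i ^ 2 ≤ p i * q i) (hr : ∀ i ∈ s, p (e i) + q i ≤ 2 * r) :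
    |∑ i ∈ s, x i * x (e i) * l i| ≤ r * ∑ i ∈ s, x i ^ 2 := by
  have hsum (f : ι → ℝ) : ∑ i ∈ s, f (e i) = ∑ i ∈ s, f i :=
    Finset.sum_equiv e (fun i => (he i).symm) fun _ _ => rfl
  have h : 2 * |∑ i ∈ s, x i * x (e i) * l i| ≤ 2 * (r * ∑ i ∈ s, x i ^ 2) := by
    calc 2 * |∑ i ∈ s, x i * x (e i) * l i|
        ≤ 2 * ∑ i ∈ s, |x i * x (e i) * l i| := by
          gcongr
          exact Finset.abs_sum_le_sum_abs _ _
      _ = ∑ i ∈ s, 2 * |x i * x (e i) * l i| := Finset.mul_sum _ _ _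
      _ ≤ ∑ i ∈ s, (p i * x i ^ 2 + q i * x (e i) ^ 2) :=
          Finset.sum_le_sum fun i hi => two_mul_abs_mul_mul_le (hp i hi) (hq i hi) (hl i hi)
      _ = ∑ i ∈ s, (p (e i) + q i) * x (e i) ^ 2 := by
          simp only [add_mul, Finset.sum_add_distrib]
          rw [hsum fun i => p i * x i ^ 2]
      _ ≤ ∑ i ∈ s, 2 * r * x (e i) ^ 2 :=
          Finset.sum_le_sum fun i hi => mul_le_mul_of_nonneg_right (hr i hi) (sq_nonneg _)
      _ = 2 * (r * ∑ i ∈ s, x i ^ 2) := by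
          rw [hsum fun i => 2 * r * x i ^ 2, ← Finset.mul_sum, mul_assoc]
  linarith

lemma abs_sum_doubling_le {n : ℕ} (hn : 3 ≤ n) (hodd : Odd n) [NeZero n] (x : ZMod n → ℝ) :
    |∑ k ∈ Finset.univ.erase (0 : ZMod n), x k * x (2 * k) * abs (Real.cos (π * k.val / n))|
      ≤ (1 - 1 / (100 * (Nat.log 2 n : ℝ) ^ 2)) * ∑ k ∈ Finset.univ.erase (0 : ZMod n), x k ^ 2 := by
  have hu : IsUnit (2 : ZMod n) := by
    exact_mod_cast (ZMod.isUnit_iff_coprime 2 n).2 hodd.coprime_two_left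
  set L := Nat.log 2 n
  have hL : 1 ≤ L := Nat.log_pos one_lt_two (by omega)
  have hL' : (1 : ℝ) ≤ L := by exact_mod_cast hL
  have hlevel (k : ZMod n) : Nat.log 2 (cycleDist k) ≤ L := Nat.log_mono_right (cycleDist_le k)
  have hδ : 1 / (100 * (L : ℝ) ^ 2) ≤ 1 / 100 :=
    one_div_le_one_div_of_le (by norm_num) (by nlinarith)
  have hdouble {k : ZMod n} (hk0 : k ≠ 0) (hk : 4 * cycleDist k < n) :
      Nat.log 2 (cycleDist (2 * k)) = Nat.log 2 (cycleDist k) + 1 := by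
    rw [cycleDist_two_mul hk, mul_comm, Nat.log_mul_base one_lt_two (cycleDist_pos hk0).ne']
  have hsucc {k : ZMod n} (hk0 : k ≠ 0) (hk : 4 * cycleDist k < n) :
      Nat.log 2 (cycleDist k) + 1 ≤ L := hdouble hk0 hk ▸ hlevel (2 * k)
  let w (j : ℕ) : ℝ := levelWeight L j
  let p (k : ZMod n) : ℝ := if 4 * cycleDist k < n then
    w (Nat.log 2 (cycleDist k) + 1) / w (Nat.log 2 (cycleDist k)) else 71 / 100
  let q (k : ZMod n) : ℝ := if 4 * cycleDist k < n then
    w (Nat.log 2 (cycleDist k)) / w (Nat.log 2 (cycleDist k) + 1) else 71 / 100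
  refine abs_sum_mul_comp_le _ (Units.mulLeft hu.unit) ?_ x _ p q _ ?_ ?_ ?_ ?_
  · intro k
    simp [hu.mul_right_eq_zero]
  · intro k hk
    dsimp only [p, w]
    split_ifs with h
    · exact (div_pos (levelWeight_pos hL (hsucc (by simpa using hk) h))
        (levelWeight_pos hL (hlevel k))).le
    · norm_num
  · intro k hk
    dsimp only [q, w]
    split_ifs with h
    · exact (div_pos (levelWeight_pos hL (hlevel k))
        (levelWeight_pos hL (hsucc (by simpa using hk) h))).le
    · norm_num
  · intro k hk
    rw [sq_abs]
    dsimp only [p, q, w]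
    split_ifs with h
    · rw [div_mul_div_cancel₀ (levelWeight_pos hL (hlevel k)).ne',
        div_self (levelWeight_pos hL (hsucc (by simpa using hk) h)).ne']
      exact Real.cos_sq_le_one _
    · exact (cos_sq_le_half (not_lt.1 h)).trans (by norm_num)
  · intro k hk
    have hk0 : k ≠ 0 := by simpa using hk
    change p (2 * k) + q k ≤ _
    have hp : p (2 * k) ≤ 1 := by
      dsimp only [p, w]
      split_ifs
      · exact levelWeight_succ_div_le hL (hlevel _)
      · norm_num
    by_cases h : 4 * cycleDist k < n
    · have hq : q k ≤ 5 / 4 := by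
        dsimp only [q, w]
        rw [if_pos h]
        exact levelWeight_div_succ_le hL (hsucc hk0 h)
      by_cases h2 : 4 * cycleDist (2 * k) < n
      · dsimp only [p, q, w]
        rw [if_pos h, if_pos h2, hdouble hk0 h]
        exact levelWeight_div_add_div_le hL (hsucc hk0 h)
      · have : p (2 * k) = 71 / 100 := if_neg h2
        linarith
    · have : q k = 71 / 100 := if_neg h
      linarith

lemma sum_range_erase_zero_natCast {n : ℕ} [NeZero n] (f : ZMod n → ℝ) :
    ∑ k ∈ (Finset.range n).erase 0, f (k : ZMod n) = ∑ k ∈ Finset.univ.erase (0 : ZMod n), f k := by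
  refine Finset.sum_bij' (fun k _ => (k : ZMod n)) (fun k _ => k.val) ?_ ?_ ?_ ?_ ?_
  · intro k hk
    simp only [mem_erase, mem_range] at hk
    simp only [mem_erase, mem_univ, and_true, ne_eq, ZMod.natCast_eq_zero_iff]
    exact fun h => absurd (Nat.le_of_dvd (Nat.pos_of_ne_zero hk.1) h) (not_le.2 hk.2)
  · intro k hk
    simpa [ZMod.val_lt] using hk
  · intro k hk
    simp only [mem_erase, mem_range] at hk
    exact ZMod.val_cast_of_lt hk.2
  · intro k _
    simp
  · intro k _
    rfl

/-- **Quadratic form bound (Proposition 1 of Miller–Venkatesan).**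
There is an absolute constant `c > 0` such that for every odd `n ≥ 3`, the
quadratic form `Q(x) = ∑_{k≠0} x_k x_{2k} λ_k` on `ℝ^{n-1}`, where
`λ_k = |cos(π k / n)|` and indices are taken in `ℤ/nℤ`, satisfies
`|Q(x)| ≤ (1 - c/(log n)²) ∑_{k≠0} x_k²`. -/
theorem quadratic_form_bound :
    ∃ c : ℝ, 0 < c ∧ ∀ n : ℕ, 3 ≤ n → Odd n → ∀ x : ZMod n → ℝ,
      |∑ k ∈ (Finset.range n).erase 0,
          x (k : ZMod n) * x (2 * (k : ZMod n)) * abs (Real.cos (π * k / n))|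
        ≤ (1 - c / (Real.log n) ^ 2) *
            ∑ k ∈ (Finset.range n).erase 0, (x (k : ZMod n)) ^ 2 := by
  have hlog2 : 0 < Real.log 2 := Real.log_pos one_lt_two
  refine ⟨Real.log 2 ^ 2 / 100, by positivity, fun n hn hodd x => ?_⟩
  have : NeZero n := ⟨by omega⟩
  have hsum : ∑ k ∈ (Finset.range n).erase 0,
      x (k : ZMod n) * x (2 * (k : ZMod n)) * |Real.cos (π * k / n)| =
      ∑ k ∈ Finset.univ.erase (0 : ZMod n), x k * x (2 * k) * |Real.cos (π * k.val / n)| := by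
    rw [← sum_range_erase_zero_natCast]
    refine Finset.sum_congr rfl fun k hk => ?_
    rw [ZMod.val_cast_of_lt (mem_range.1 (mem_of_mem_erase hk))]
  rw [hsum, sum_range_erase_zero_natCast fun k => x k ^ 2]
  refine (abs_sum_doubling_le hn hodd x).trans
    (mul_le_mul_of_nonneg_right ?_ (Finset.sum_nonneg fun _ _ => sq_nonneg _))
  have hL : (1 : ℝ) ≤ Nat.log 2 n := by
    exact_mod_cast (Nat.log_pos one_lt_two (by omega) : 0 < Nat.log 2 n)
  have hle : (Nat.log 2 n : ℝ) * Real.log 2 ≤ Real.log n := by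
    rw [← Real.log_pow]
    exact Real.log_le_log (by positivity) (by exact_mod_cast Nat.pow_log_le_self 2 (by omega))
  have hlogn : 0 < Real.log n := lt_of_lt_of_le (by positivity) hle
  have hsq := pow_le_pow_left₀ (by positivity) hle 2
  apply sub_le_sub_left
  rw [div_div, div_le_div_iff₀ (by positivity) (by positivity)]
  nlinarith
end

section
/- There exists an absolute constant c > 0 with the following property. Let n be an odd prime, let y ∈ ℤ/nℤ with y ≠ 1, and let A be the adjacency operator of the Pollard ρ graph on ℤ/nℤ, acting on functions f : ℤ/nℤ → ℂ by (Af)(x) = f(x+1) + f(x+y) + f(2x). Then for every f with Σ_{x ∈ ℤ/nℤ} f(x) = 0 one has ‖Af‖ ≤ (3 − c/(log n)²) · ‖f‖, where ‖f‖² = Σ_{x ∈ ℤ/nℤ} |f(x)|². -/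
open Finset Real

/-- Doubling an angle: as long as the powers `z ^ 2 ^ m` stay in the right half plane, the distance
of their real part to `1` at least doubles. -/
lemma two_pow_mul_one_sub_re_le {z : ℂ} (hz : ‖z‖ = 1) (L : ℕ)
    (h : ∀ m < L, 0 < (z ^ 2 ^ m).re) : 2 ^ L * (1 - z.re) ≤ 1 - (z ^ 2 ^ L).re := by
  induction L with
  | zero => simp
  | succ L ih =>
    have ih := ih fun m hm => h m (by omega)
    have hpos := h L (by omega)
    set u := z ^ 2 ^ L with hu
    have hn : u.re * u.re + u.im * u.im = 1 := by
      have : ‖u‖ = 1 := by rw [hu, norm_pow, hz, one_pow]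
      rw [← Complex.normSq_apply, Complex.normSq_eq_norm_sq, this, one_pow]
    have hle : u.re ≤ 1 := by nlinarith
    have : z ^ 2 ^ (L + 1) = u * u := by rw [hu, ← pow_two, ← pow_mul, pow_succ]
    rw [this, Complex.mul_re, pow_succ]
    nlinarith

/-- An `n`-th root of unity different from `1` is at distance at least `2 / n` from `1`. -/
lemma two_div_le_norm_one_sub_of_pow_eq_one {z : ℂ} {n : ℕ} (hn : 0 < n) (hz : z ^ n = 1)
    (hz1 : z ≠ 1) : 2 / (n : ℝ) ≤ ‖1 - z‖ := by
  have hnorm : ‖z‖ = 1 := Complex.norm_eq_one_of_pow_eq_one hz hn.ne'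
  have hgeom : ∑ i ∈ range n, z ^ i = 0 := by
    have := geom_sum_mul z n
    rw [hz, sub_self] at this
    exact (mul_eq_zero.mp this).resolve_right (sub_ne_zero.mpr hz1)
  have hpow (i : ℕ) : ‖1 - z ^ i‖ ≤ i * ‖1 - z‖ := by
    induction i with
    | zero => simp
    | succ i ih =>
      have : 1 - z ^ (i + 1) = (1 - z ^ i) + z ^ i * (1 - z) := by ring
      calc ‖1 - z ^ (i + 1)‖ ≤ ‖1 - z ^ i‖ + ‖z ^ i * (1 - z)‖ := this ▸ norm_add_le _ _
        _ ≤ i * ‖1 - z‖ + ‖1 - z‖ := by rw [norm_mul, norm_pow, hnorm, one_pow, one_mul]; gcongr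
        _ = _ := by push_cast; ring
  have hsum : (n : ℝ) ≤ (∑ i ∈ range n, (i : ℝ)) * ‖1 - z‖ := by
    calc (n : ℝ) = ‖∑ i ∈ range n, (1 - z ^ i)‖ := by simp [sum_sub_distrib, hgeom]
      _ ≤ ∑ i ∈ range n, ‖1 - z ^ i‖ := norm_sum_le _ _
      _ ≤ ∑ i ∈ range n, i * ‖1 - z‖ := sum_le_sum fun i _ => hpow i
      _ = _ := by rw [sum_mul]
  have hgauss : (∑ i ∈ range n, (i : ℝ)) * 2 = n * (n - 1) := by
    have := sum_range_id_mul_two n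
    rw [← Nat.cast_inj (R := ℝ)] at this
    push_cast [Nat.cast_sub hn] at this
    exact this
  have hn' : (0 : ℝ) < n := by exact_mod_cast hn
  rw [div_le_iff₀ hn']
  have h2 : (n : ℝ) * 2 ≤ n * ((n - 1) * ‖1 - z‖) := by
    rw [← mul_assoc, ← hgauss]; linarith
  have := le_of_mul_le_mul_left h2 hn'
  nlinarith [norm_nonneg (1 - z)]

/-- Repeatedly squaring an `n`-th root of unity `z ≠ 1` leads out of the right half plane in
fewer than `L` steps as soon as `n ^ 2 < 2 ^ L`. -/
lemma exists_pow_two_pow_re_nonpos {z : ℂ} {n L : ℕ} (hn : 0 < n) (hL : n ^ 2 < 2 ^ L)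
    (hz : z ^ n = 1) (hz1 : z ≠ 1) : ∃ m < L, (z ^ 2 ^ m).re ≤ 0 := by
  by_contra! h
  have hnorm : ‖z‖ = 1 := Complex.norm_eq_one_of_pow_eq_one hz hn.ne'
  have h1 := two_pow_mul_one_sub_re_le hnorm L h
  have h2 := two_div_le_norm_one_sub_of_pow_eq_one hn hz hz1
  have hsq : ‖1 - z‖ ^ 2 = 2 * (1 - z.re) := by
    have hz' : z.re * z.re + z.im * z.im = 1 := by
      rw [← Complex.normSq_apply, Complex.normSq_eq_norm_sq, hnorm, one_pow]
    rw [← Complex.normSq_eq_norm_sq, Complex.normSq_apply]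
    simp only [Complex.sub_re, Complex.sub_im, Complex.one_re, Complex.one_im]
    linarith
  have hn' : (0 : ℝ) < n := by exact_mod_cast hn
  have h3 : 2 / (n : ℝ) ^ 2 ≤ 1 - z.re := by
    have : (2 / (n : ℝ)) ^ 2 ≤ ‖1 - z‖ ^ 2 := by gcongr
    rw [hsq, div_pow] at this
    linarith [show (2 : ℝ) ^ 2 / n ^ 2 = 2 * (2 / n ^ 2) by ring]
  have h4 : -1 ≤ (z ^ 2 ^ L).re := by
    have := Complex.abs_re_le_norm (z ^ 2 ^ L)
    rw [norm_pow, hnorm, one_pow] at this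
    exact (abs_le.mp this).1
  have hL' : (n : ℝ) ^ 2 < 2 ^ L := by exact_mod_cast hL
  have h5 : (n : ℝ) ^ 2 * (2 / (n : ℝ) ^ 2) < 2 ^ L * (2 / (n : ℝ) ^ 2) := by gcongr
  rw [mul_div_cancel₀ _ (by positivity)] at h5
  have h6 : (2 : ℝ) ^ L * (2 / (n : ℝ) ^ 2) ≤ 2 ^ L * (1 - z.re) := by gcongr
  linarith

/-- A quadratic form along a permutation whose weights are at most `1`, and at most `71 / 100`
somewhere in every orbit segment of length `L`, has norm at most `1 - 7 / (128 L²)`. -/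
lemma sum_mul_mul_comp_perm_le {V : Type*} [Fintype V] (σ : Equiv.Perm V) (w a : V → ℝ)
    (hw0 : ∀ v, 0 ≤ w v) (hw1 : ∀ v, w v ≤ 1) {L : ℕ} (hL : 0 < L)
    (h : ∀ v, ∃ m < L, w ((σ ^ m) v) ≤ 71 / 100) :
    ∑ v, w v * (a v * a (σ v)) ≤ (1 - 7 / (128 * (L : ℝ) ^ 2)) * ∑ v, a v ^ 2 := by
  classical
  have h' : ∀ v, ∃ m, w ((σ ^ m) v) ≤ 71 / 100 := fun v => (h v).imp fun _ => And.right
  let t : V → ℕ := fun v => Nat.find (h' v)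
  have ht : ∀ v, t v + 1 ≤ L := fun v =>
    have ⟨m, hm, hv⟩ := h v
    Nat.succ_le_of_lt ((Nat.find_min' (h' v) hv).trans_lt hm)
  have ht0 : ∀ v, t v = 0 → w v ≤ 71 / 100 := fun v hv => by
    simpa [t, hv] using Nat.find_spec (h' v)
  have hts : ∀ v, t v ≠ 0 → t v = t (σ v) + 1 := fun v hv => by
    have hsucc (m : ℕ) : (σ ^ (m + 1)) v = (σ ^ m) (σ v) := by rw [pow_succ, Equiv.Perm.mul_apply]
    obtain ⟨m, hm⟩ := Nat.exists_eq_succ_of_ne_zero hv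
    have hspec := Nat.find_spec (h' v)
    change w ((σ ^ t v) v) ≤ _ at hspec
    rw [hm, Nat.succ_eq_add_one, hsucc] at hspec
    have h1 : t (σ v) ≤ m := Nat.find_min' (h' (σ v)) hspec
    have hspec' := Nat.find_spec (h' (σ v))
    rw [← hsucc] at hspec'
    have h2 : t v ≤ t (σ v) + 1 := Nat.find_min' (h' v) hspec'
    omega
  have hL1 : (1 : ℝ) ≤ L := by exact_mod_cast hL
  set g : V → ℝ := fun v => 1 + t v / (8 * (L : ℝ) ^ 2) with hg
  have hg1 : ∀ v, 1 ≤ g v := fun v => by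
    have : (0 : ℝ) ≤ t v / (8 * (L : ℝ) ^ 2) := by positivity
    simp only [hg]
    linarith
  have key : ∀ v, w (σ v) * g (σ v) + w v * (g v)⁻¹ ≤ 2 - 7 / (64 * (L : ℝ) ^ 2) := fun v => by
    have hw : w (σ v) * g (σ v) ≤ g (σ v) :=
      mul_le_of_le_one_left (by linarith [hg1 (σ v)]) (hw1 _)
    obtain ⟨d, hd⟩ : ∃ d, d = 1 / (8 * (L : ℝ) ^ 2) := ⟨_, rfl⟩
    have hd0 : 0 < d := by rw [hd]; positivity
    have hdL : 8 * d * L ^ 2 = 1 := by rw [hd]; field_simp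
    have hd1 : 8 * d * L ≤ 1 := by nlinarith [mul_pos hd0 (by linarith : (0 : ℝ) < L)]
    have hgd : ∀ v, g v = 1 + t v * d := fun v => by rw [hd, hg, mul_one_div]
    have h7 : 7 / (64 * (L : ℝ) ^ 2) = 7 / 8 * d := by rw [hd]; field_simp; norm_num
    have htL : ∀ v, (t v : ℝ) + 1 ≤ L := fun v => by exact_mod_cast ht v
    rw [h7]
    by_cases hv : t v = 0
    · have h1 : w v * (g v)⁻¹ ≤ 71 / 100 := by
        simpa [hg, hv] using ht0 v hv
      have h2 : t (σ v) * d ≤ 1 / 8 := by nlinarith [htL (σ v)]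
      rw [hgd (σ v)] at hw ⊢
      nlinarith
    · have hq : ((t (σ v) : ℝ) + 1) * d ≤ L * d := by gcongr; exact htL _
      have hgv : g v = 1 + (t (σ v) + 1) * d := by rw [hgd, hts v hv]; push_cast; ring
      have hq0 : 0 ≤ ((t (σ v) : ℝ) + 1) * d := by positivity
      have hinv : (g v)⁻¹ ≤ 1 - (t (σ v) + 1) * d + (L * d) ^ 2 := by
        rw [hgv, inv_le_iff_one_le_mul₀ (by positivity)]
        nlinarith [pow_le_pow_left₀ hq0 hq 2, pow_nonneg hq0 3,
          mul_nonneg hq0 (sub_nonneg.mpr (pow_le_pow_left₀ hq0 hq 2))]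
      have h1 : w v * (g v)⁻¹ ≤ (g v)⁻¹ :=
        mul_le_of_le_one_left (by have := hg1 v; positivity) (hw1 _)
      have h2 : (L * d) ^ 2 = d / 8 := by linear_combination d / 8 * hdL
      rw [hgd (σ v)] at hw ⊢
      linarith
  have amgm : ∀ v, w v * (a v * a (σ v)) ≤
      (w v * g v * a v ^ 2 + w v * (g v)⁻¹ * a (σ v) ^ 2) / 2 := fun v => by
    have hgv : 0 < g v := by linarith [hg1 v]
    have : 0 ≤ (g v)⁻¹ * (g v * a v - a (σ v)) ^ 2 := by positivity
    have e : (g v)⁻¹ * (g v * a v - a (σ v)) ^ 2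
        = g v * a v ^ 2 + (g v)⁻¹ * a (σ v) ^ 2 - 2 * (a v * a (σ v)) := by field_simp; ring
    rw [e] at this
    nlinarith [mul_nonneg (hw0 v) this]
  have reindex (f : V → ℝ) : ∑ v, f (σ v) = ∑ v, f v := Equiv.sum_comp σ f
  calc ∑ v, w v * (a v * a (σ v))
      ≤ ∑ v, (w v * g v * a v ^ 2 + w v * (g v)⁻¹ * a (σ v) ^ 2) / 2 := sum_le_sum fun v _ => amgm v
    _ = ∑ v, (w (σ v) * g (σ v) + w v * (g v)⁻¹) / 2 * a (σ v) ^ 2 := by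
      simp_rw [add_div, add_mul, sum_add_distrib]
      rw [← reindex fun v => w v * g v * a v ^ 2 / 2]
      congr 1 <;> exact sum_congr rfl fun v _ => by ring
    _ ≤ ∑ v, (1 - 7 / (128 * (L : ℝ) ^ 2)) * a (σ v) ^ 2 := by
      refine sum_le_sum fun v _ => mul_le_mul_of_nonneg_right ?_ (sq_nonneg _)
      have : 7 / (64 * (L : ℝ) ^ 2) = 2 * (7 / (128 * (L : ℝ) ^ 2)) := by field_simp; norm_num
      linarith [key v]
    _ = _ := by rw [← mul_sum, reindex fun v => a v ^ 2]

/-- **Parseval's identity** for the discrete Fourier transform. -/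
lemma sum_norm_sq_dft {n : ℕ} [NeZero n] (f : ZMod n → ℂ) :
    ∑ k, ‖ZMod.dft f k‖ ^ 2 = n * ∑ x, ‖f x‖ ^ 2 := by
  have hself (z : ℂ) : ((‖z‖ ^ 2 : ℝ) : ℂ) = z * starRingEnd ℂ z := by
    rw [Complex.mul_conj, Complex.normSq_eq_norm_sq]
  have hinv (x : ZMod n) : ∑ k, ZMod.stdAddChar (x * k) * ZMod.dft f k = n * f x := by
    have := congrFun (ZMod.dft_dft f) (-x)
    rw [ZMod.dft_apply] at this
    simpa [mul_comm x] using this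
  rw [← Complex.ofReal_inj]
  push_cast [hself]
  calc ∑ k, ZMod.dft f k * starRingEnd ℂ (ZMod.dft f k)
      = ∑ k, ∑ x, f x * starRingEnd ℂ (ZMod.stdAddChar (x * k) * ZMod.dft f k) := by
        refine sum_congr rfl fun k _ => ?_
        nth_rewrite 1 [ZMod.dft_apply]
        rw [sum_mul]
        refine sum_congr rfl fun x _ => ?_
        rw [AddChar.map_neg_eq_conj, map_mul (starRingEnd ℂ), smul_eq_mul]
        ring
    _ = ∑ x, f x * starRingEnd ℂ (n * f x) := by
        rw [sum_comm]
        simp_rw [← mul_sum, ← map_sum, hinv]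
    _ = _ := by
        rw [mul_sum]
        refine sum_congr rfl fun x _ => ?_
        rw [map_mul, Complex.conj_natCast]
        ring

lemma dft_comp_add_right {n : ℕ} [NeZero n] (f : ZMod n → ℂ) (y k : ZMod n) :
    ZMod.dft (fun x => f (x + y)) k = ZMod.stdAddChar (y * k) * ZMod.dft f k := by
  simp only [ZMod.dft_apply, smul_eq_mul]
  rw [mul_sum]
  refine Fintype.sum_equiv (Equiv.addRight y) _ _ fun x => ?_
  rw [Equiv.coe_addRight, ← mul_assoc, ← AddChar.map_add_eq_mul]
  congr 2
  ring

/-- On the Fourier side the Pollard `ρ` adjacency operator is a multiplier plus a dilation. -/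
lemma dft_pollard {n : ℕ} [NeZero n] (u : (ZMod n)ˣ) (y : ZMod n) (f : ZMod n → ℂ) (k : ZMod n) :
    ZMod.dft (fun x => f (x + 1) + f (x + y) + f (u.val * x)) k =
      (ZMod.stdAddChar k + ZMod.stdAddChar (y * k)) * ZMod.dft f k +
        ZMod.dft f (u⁻¹.val * k) := by
  have h : (fun x => f (x + 1) + f (x + y) + f (u.val * x)) =
      (fun x => f (x + 1)) + (fun x => f (x + y)) + fun x => f (u.val * x) := rfl
  rw [h, map_add, map_add, Pi.add_apply, Pi.add_apply, dft_comp_add_right, dft_comp_add_right,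
    ZMod.dft_comp_unitMul, one_mul, add_mul]

/-- The norm of the multiplier in `dft_pollard`. -/
lemma norm_stdAddChar_add {n : ℕ} [NeZero n] (y k : ZMod n) :
    ‖(ZMod.stdAddChar k + ZMod.stdAddChar (y * k) : ℂ)‖ =
      ‖(1 + ZMod.stdAddChar ((y - 1) * k) : ℂ)‖ := by
  have : (ZMod.stdAddChar k + ZMod.stdAddChar (y * k) : ℂ) =
      ZMod.stdAddChar k * (1 + ZMod.stdAddChar ((y - 1) * k)) := by
    rw [mul_add, mul_one, ← AddChar.map_add_eq_mul]
    congr 2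
    ring
  rw [this, norm_mul, AddChar.norm_apply, one_mul]

lemma norm_one_add_le_of_re_nonpos {z : ℂ} (hz : ‖z‖ = 1) (h : z.re ≤ 0) :
    ‖1 + z‖ ≤ 71 / 50 := by
  have hz' : z.re * z.re + z.im * z.im = 1 := by
    rw [← Complex.normSq_apply, Complex.normSq_eq_norm_sq, hz, one_pow]
  refine abs_le_of_sq_le_sq' ?_ (by norm_num) |>.2
  rw [← Complex.normSq_eq_norm_sq, Complex.normSq_apply]
  simp only [Complex.add_re, Complex.add_im, Complex.one_re, Complex.one_im]
  nlinarith

/-- Doubling a nonzero frequency fewer than `L` times makes the multiplier small. -/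
lemma exists_norm_one_add_stdAddChar_le {n : ℕ} [NeZero n] {L : ℕ} (hL : n ^ 2 < 2 ^ L)
    {k : ZMod n} (hk : k ≠ 0) :
    ∃ m < L, ‖(1 + ZMod.stdAddChar (2 ^ m * k) : ℂ)‖ ≤ 71 / 50 := by
  have hpow (m : ℕ) : (ZMod.stdAddChar k : ℂ) ^ m = ZMod.stdAddChar ((m : ZMod n) * k) := by
    rw [← AddChar.map_nsmul_eq_pow, nsmul_eq_mul]
  have h1 : (ZMod.stdAddChar k : ℂ) ^ n = 1 := by
    rw [hpow, ZMod.natCast_self, zero_mul, AddChar.map_zero_eq_one]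
  have h2 : (ZMod.stdAddChar k : ℂ) ≠ 1 := fun h =>
    hk (ZMod.injective_stdAddChar (h.trans (AddChar.map_zero_eq_one _).symm))
  obtain ⟨m, hm, hre⟩ := exists_pow_two_pow_re_nonpos (NeZero.pos n) hL h1 h2
  rw [hpow] at hre
  push_cast at hre
  exact ⟨m, hm, norm_one_add_le_of_re_nonpos (AddChar.norm_apply _ _) hre⟩

/-- The operator bound in squared form, with the logarithm replaced by any `L` such that
`n ^ 2 < 2 ^ L`. -/
lemma sum_norm_sq_pollard_le {n : ℕ} [NeZero n] (hn : n.Prime) (hodd : Odd n) {L : ℕ}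
    (hL : n ^ 2 < 2 ^ L) {y : ZMod n} (hy : y ≠ 1) {f : ZMod n → ℂ} (hf : ∑ x, f x = 0) :
    ∑ x, ‖f (x + 1) + f (x + y) + f (2 * x)‖ ^ 2 ≤
      (9 - 7 / (32 * (L : ℝ) ^ 2)) * ∑ x, ‖f x‖ ^ 2 := by
  have : Fact n.Prime := ⟨hn⟩
  have hL0 : 0 < L := Nat.pos_of_ne_zero fun h => by
    have := hn.pos
    rw [h, pow_zero] at hL
    nlinarith
  let u : (ZMod n)ˣ := ZMod.unitOfCoprime 2 (Nat.coprime_two_left.mpr hodd)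
  have hu : u.val = 2 := by simp [u]
  let σ : Equiv.Perm (ZMod n) := u.mulLeft
  have hσ (k : ZMod n) : σ k = 2 * k := by simp [σ, hu]
  have hσpow (m : ℕ) (k : ZMod n) : (σ ^ m) k = 2 ^ m * k := by
    induction m with
    | zero => simp
    | succ m ih => rw [pow_succ', Equiv.Perm.mul_apply, ih, hσ]; ring
  set F := ZMod.dft f with hF
  have hF0 : F 0 = 0 := by rw [hF, ZMod.dft_apply_zero, hf]
  let W : ZMod n → ℝ := fun k => ‖(1 + ZMod.stdAddChar ((y - 1) * k) : ℂ)‖ / 2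
  have hW0 (k) : 0 ≤ W k := by positivity
  have hW1 (k) : W k ≤ 1 := by
    have := norm_add_le (1 : ℂ) (ZMod.stdAddChar ((y - 1) * k))
    rw [AddChar.norm_apply, norm_one] at this
    simp only [W]
    linarith
  let w : ZMod n → ℝ := fun k => if k = 0 then 0 else W (2 * k)
  have hsmall (k : ZMod n) : ∃ m < L, w ((σ ^ m) k) ≤ 71 / 100 := by
    by_cases hk : k = 0
    · refine ⟨0, hL0, ?_⟩
      simp [w, hk]
      norm_num
    · have h2 : (2 : ZMod n) ≠ 0 := hu ▸ u.ne_zero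
      obtain ⟨m, hm, h⟩ := exists_norm_one_add_stdAddChar_le hL
        (mul_ne_zero (sub_ne_zero.mpr hy) (mul_ne_zero h2 hk))
      refine ⟨m, hm, ?_⟩
      have hne : 2 ^ m * k ≠ 0 := mul_ne_zero (pow_ne_zero _ h2) hk
      have e : 2 ^ m * ((y - 1) * (2 * k)) = (y - 1) * (2 * (2 ^ m * k)) := by ring
      rw [e] at h
      simp only [hσpow, w, hne, if_false, W]
      linarith
  have hform := sum_mul_mul_comp_perm_le σ w (fun k => ‖F k‖)
    (fun k => by simp only [w]; split_ifs <;> simp [hW0])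
    (fun k => by simp only [w]; split_ifs <;> simp [hW1]) hL0 hsmall
  have hbound (k : ZMod n) :
      ‖ZMod.dft (fun x => f (x + 1) + f (x + y) + f (2 * x)) (2 * k)‖ ^ 2 ≤
        4 * ‖F (σ k)‖ ^ 2 + ‖F k‖ ^ 2 + 4 * (w k * (‖F k‖ * ‖F (σ k)‖)) := by
    have hinv : u⁻¹.val * (2 * k) = k := by rw [← hu, Units.inv_mul_cancel_left]
    have hd := dft_pollard u y f (2 * k)
    rw [hu, hinv] at hd
    have hle : ‖ZMod.dft (fun x => f (x + 1) + f (x + y) + f (2 * x)) (2 * k)‖ ≤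
        2 * W (2 * k) * ‖F (σ k)‖ + ‖F k‖ := by
      rw [hd]
      refine (norm_add_le _ _).trans_eq ?_
      rw [norm_mul, norm_stdAddChar_add, hσ]
      simp only [W]
      ring
    have hw : w k * (‖F k‖ * ‖F (σ k)‖) = W (2 * k) * (‖F k‖ * ‖F (σ k)‖) := by
      by_cases hk : k = 0
      · simp [hk, hF0]
      · simp [w, hk]
    have hW2 : W (2 * k) ^ 2 ≤ 1 := pow_le_one₀ (hW0 _) (hW1 _)
    rw [hw]
    calc _ ≤ (2 * W (2 * k) * ‖F (σ k)‖ + ‖F k‖) ^ 2 := by gcongr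
      _ = 4 * (W (2 * k) ^ 2 * ‖F (σ k)‖ ^ 2) + ‖F k‖ ^ 2 +
          4 * (W (2 * k) * (‖F k‖ * ‖F (σ k)‖)) := by ring
      _ ≤ _ := by
        gcongr
        exact mul_le_of_le_one_left (sq_nonneg _) hW2
  have hn0 : (0 : ℝ) < n := by exact_mod_cast hn.pos
  refine le_of_mul_le_mul_left ?_ hn0
  have e : 7 / (32 * (L : ℝ) ^ 2) = 4 * (7 / (128 * (L : ℝ) ^ 2)) := by field_simp; norm_num
  calc (n : ℝ) * ∑ x, ‖f (x + 1) + f (x + y) + f (2 * x)‖ ^ 2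
      = ∑ k, ‖ZMod.dft (fun x => f (x + 1) + f (x + y) + f (2 * x)) (2 * k)‖ ^ 2 := by
        rw [← sum_norm_sq_dft, ← Equiv.sum_comp σ]
        simp_rw [hσ]
    _ ≤ ∑ k, (4 * ‖F (σ k)‖ ^ 2 + ‖F k‖ ^ 2 + 4 * (w k * (‖F k‖ * ‖F (σ k)‖))) :=
        sum_le_sum fun k _ => hbound k
    _ = 5 * ∑ k, ‖F k‖ ^ 2 + 4 * ∑ k, w k * (‖F k‖ * ‖F (σ k)‖) := by
        rw [sum_add_distrib, sum_add_distrib, ← mul_sum, ← mul_sum,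
          Equiv.sum_comp σ fun k => ‖F k‖ ^ 2]
        ring
    _ ≤ (9 - 7 / (32 * (L : ℝ) ^ 2)) * ∑ k, ‖F k‖ ^ 2 := by
        rw [e]
        linarith
    _ = _ := by rw [hF, sum_norm_sq_dft]; ring

/-- **Operator norm bound for the Pollard ρ graph (Proposition 2 of Miller–Venkatesan).**
There is an absolute constant `c > 0` such that for every odd prime `n` and every
`y ∈ ℤ/nℤ`, `y ≠ 1`, the adjacency operator `(Af)(x) = f(x+1) + f(x+y) + f(2x)` of
the Pollard ρ graph satisfies `‖Af‖ ≤ (3 - c/(log n)²)‖f‖` for every `f ⊥ 𝟙`. -/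
theorem pollard_rho_operator_norm_bound :
    ∃ c : ℝ, 0 < c ∧ ∀ (n : ℕ) [NeZero n], n.Prime → Odd n →
      ∀ y : ZMod n, y ≠ 1 →
        ∀ f : ZMod n → ℂ, (∑ x : ZMod n, f x) = 0 →
          Real.sqrt (∑ x : ZMod n, ‖f (x + 1) + f (x + y) + f (2 * x)‖ ^ 2)
            ≤ (3 - c / (Real.log n) ^ 2) * Real.sqrt (∑ x : ZMod n, ‖f x‖ ^ 2) := by
  refine ⟨1 / 1000, by norm_num, fun n _ hn hodd y hy f hf => ?_⟩
  have hn3 : 3 ≤ n := by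
    have := hn.two_le
    have : n ≠ 2 := by rintro rfl; exact absurd hodd (by decide)
    omega
  have hlog1 : 1 ≤ Real.log n := by
    rw [Real.le_log_iff_exp_le (by positivity)]
    have : (3 : ℝ) ≤ n := by exact_mod_cast hn3
    linarith [Real.exp_one_lt_d9]
  set L := Nat.log 2 (n ^ 2) + 1 with hLdef
  have hL : n ^ 2 < 2 ^ L := Nat.lt_pow_succ_log_self (by norm_num) _
  have hLlog : (L : ℝ) ≤ 4 * Real.log n := by
    have h1 : ((2 : ℝ) ^ Nat.log 2 (n ^ 2)) ≤ (n : ℝ) ^ 2 := by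
      exact_mod_cast Nat.pow_log_le_self 2 (by positivity)
    have h2 := Real.log_le_log (by positivity) h1
    rw [Real.log_pow, Real.log_pow] at h2
    rw [hLdef]
    push_cast at h2 ⊢
    nlinarith [Real.log_two_gt_d9, (Nat.cast_nonneg _ : (0 : ℝ) ≤ Nat.log 2 (n ^ 2))]
  have hL0 : (0 : ℝ) < L := by rw [hLdef]; positivity
  set ε := 1 / 1000 / Real.log n ^ 2 with hε
  have hε0 : 0 ≤ ε := by positivity
  have hε1 : ε ≤ 1 / 1000 := div_le_self (by norm_num) (one_le_pow₀ hlog1)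
  have hεL : 6 * ε ≤ 7 / (32 * (L : ℝ) ^ 2) := by
    have h1 : (L : ℝ) ^ 2 ≤ (4 * Real.log n) ^ 2 := by gcongr
    rw [hε, le_div_iff₀ (by positivity), div_eq_mul_inv _ (Real.log n ^ 2)]
    have h2 : (Real.log n ^ 2)⁻¹ * (L : ℝ) ^ 2 ≤ 16 := by
      rw [inv_mul_le_iff₀ (by positivity)]
      linarith [mul_pow 4 (Real.log n) 2]
    linarith
  have hbound := sum_norm_sq_pollard_le hn hodd hL hy hf
  have hS : 0 ≤ ∑ x, ‖f x‖ ^ 2 := sum_nonneg fun x _ => sq_nonneg _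
  rw [Real.sqrt_le_iff]
  refine ⟨mul_nonneg (by linarith) (Real.sqrt_nonneg _), hbound.trans ?_⟩
  rw [mul_pow, Real.sq_sqrt hS]
  gcongr
  nlinarith
end

section
/- There exists an absolute constant c > 0 such that for every odd integer n ≥ 3 there exist positive reals (γ_k)_{k ∈ ℤ/nℤ, k≠0} satisfying γ_k λ_k + γ_{2̄k}^{-1} λ_{2̄k} ≤ 2 − c/(log n)² for every nonzero k ∈ ℤ/nℤ, where λ_k = |cos(π k̃ / n)| (k̃ any integer representative of k) and 2̄ is the multiplicative inverse of 2 modulo n. -/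
open Finset Real

/-- The distance from a residue class modulo `n` to zero. -/
def circDist {n : ℕ} (k : ZMod n) : ℕ := min k.val (n - k.val)

/-- The dyadic scale of a residue class `k`: up to rounding, how often `k` can be doubled before
it wraps around modulo `n`. -/
def dyadicLevel {n : ℕ} (k : ZMod n) : ℕ := Nat.log 2 (n / circDist k)

lemma dyadicLevel_le_log {n : ℕ} (k : ZMod n) : dyadicLevel k ≤ Nat.log 2 n :=
  Nat.log_mono_right (Nat.div_le_self _ _)

lemma circDist_two_mul {n : ℕ} [NeZero n] (j : ZMod n) (h : 4 * circDist j ≤ n) :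
    circDist (2 * j) = 2 * circDist j := by
  have hj := j.val_lt
  have hval : (2 * j).val = (2 * j.val) % n := by
    rw [two_mul, ZMod.val_add, ← two_mul]
  unfold circDist at *
  rw [hval]
  rcases lt_or_ge (2 * j.val) n with h1 | h1
  · rw [Nat.mod_eq_of_lt h1]
    omega
  · rw [Nat.mod_eq_sub_mod h1, Nat.mod_eq_of_lt (by omega)]
    omega

lemma circDist_pos {n : ℕ} [NeZero n] {j : ZMod n} (h : j ≠ 0) : 0 < circDist j := by
  have hj := j.val_lt
  have := ZMod.val_pos.2 h
  unfold circDist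
  omega

lemma dyadicLevel_eq_succ {n : ℕ} [NeZero n] {j : ZMod n} (hj : j ≠ 0)
    (h : 4 * circDist j ≤ n) : dyadicLevel j = dyadicLevel (2 * j) + 1 := by
  have hpos := circDist_pos hj
  have h4 : 4 ≤ n / circDist j := (Nat.le_div_iff_mul_le hpos).2 h
  unfold dyadicLevel
  rw [circDist_two_mul j h, mul_comm 2, ← Nat.div_div_eq_div_mul,
    Nat.log_of_one_lt_of_le one_lt_two (by omega)]

lemma abs_cos_le_of_lt_four_mul_circDist {n : ℕ} [NeZero n] (j : ZMod n)
    (h : n < 4 * circDist j) : |Real.cos (π * (j.val : ℕ) / n)| ≤ 3 / 4 := by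
  have hn : (0 : ℝ) < n := by exact_mod_cast NeZero.pos n
  have hlo : (n : ℝ) ≤ 4 * (j.val : ℝ) := by
    have : n ≤ 4 * j.val := by unfold circDist at h; omega
    exact_mod_cast this
  have hhi : 4 * (j.val : ℝ) ≤ 3 * n := by
    have : 4 * j.val ≤ 3 * n := by unfold circDist at h; omega
    exact_mod_cast this
  have hcos : Real.cos (2 * (π * (j.val : ℕ) / n)) ≤ 0 := by
    apply Real.cos_nonpos_of_pi_div_two_le_of_le
    · rw [← mul_div_assoc, div_le_div_iff₀ two_pos hn]
      nlinarith [Real.pi_pos]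
    · rw [← mul_div_assoc, div_le_iff₀ hn]
      nlinarith [Real.pi_pos]
  rw [Real.cos_two_mul] at hcos
  apply abs_le_of_sq_le_sq _ (by norm_num)
  linarith

lemma two_mul_inv_two_mul {n : ℕ} (hn : Odd n) (k : ZMod n) : 2 * ((2 : ZMod n)⁻¹ * k) = k := by
  have h := ZMod.coe_mul_inv_eq_one 2 (Nat.coprime_two_left.2 hn)
  rw [Nat.cast_ofNat] at h
  rw [← mul_assoc, h, one_mul]

/-- The step inequality for the linear weights `1 + t / (8 M²)`. -/
lemma one_add_add_inv_le {M t : ℝ} (hM : 1 ≤ M) (ht : 0 ≤ t) (htM : t + 1 ≤ M) :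
    1 + t / (8 * M ^ 2) + (1 + (t + 1) / (8 * M ^ 2))⁻¹ ≤ 2 - 1 / (100 * M ^ 2) := by
  have hM2 : 0 < M ^ 2 := by positivity
  set a := 1 / (8 * M ^ 2) with ha
  have ha0 : 0 < a := by positivity
  have hsq : (t + 1) ^ 2 * a ≤ 1 / 8 := by
    rw [ha, mul_one_div, div_le_div_iff₀ (by positivity) (by norm_num)]
    nlinarith
  have hinv : (1 + (t + 1) * a)⁻¹ ≤ 1 - (t + 1) * a + ((t + 1) * a) ^ 2 := by
    have hx : 0 ≤ (t + 1) * a := by positivity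
    rw [inv_le_iff_one_le_mul₀ (by positivity)]
    nlinarith [pow_nonneg hx 3]
  have e1 : t / (8 * M ^ 2) = t * a := by rw [ha]; ring
  have e2 : (t + 1) / (8 * M ^ 2) = (t + 1) * a := by rw [ha]; ring
  have e3 : 1 / (100 * M ^ 2) = 8 / 100 * a := by rw [ha]; field_simp
  rw [e1, e2, e3]
  nlinarith

/-- **Existence of good weights `γ_k`.**
There is an absolute constant `c > 0` such that for every odd `n ≥ 3` one can choose
positive reals `γ_k` (for nonzero `k ∈ ℤ/nℤ`) with
`γ_k λ_k + γ_{2̄k}⁻¹ λ_{2̄k} ≤ 2 - c/(log n)²` for all nonzero `k`,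
where `λ_k = |cos(π k / n)|` and `2̄` is the inverse of `2` modulo `n`. -/
theorem exists_gamma_weights :
    ∃ c : ℝ, 0 < c ∧ ∀ n : ℕ, 3 ≤ n → Odd n →
      ∃ γ : ZMod n → ℝ,
        (∀ k : ZMod n, k ≠ 0 → 0 < γ k) ∧
        ∀ k : ZMod n, k ≠ 0 →
          γ k * abs (Real.cos (π * (k.val : ℕ) / n)) +
              (γ ((2 : ZMod n)⁻¹ * k))⁻¹ *
                abs (Real.cos (π * (((2 : ZMod n)⁻¹ * k).val : ℕ) / n))
            ≤ 2 - c / (Real.log n) ^ 2 := by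
  refine ⟨(Real.log 2) ^ 2 / 100, by positivity, fun n hn hodd => ?_⟩
  have : NeZero n := ⟨by omega⟩
  set M : ℝ := (Nat.log 2 n : ℝ) with hMdef
  have hM : 1 ≤ M := by
    rw [hMdef]
    exact_mod_cast Nat.log_pos one_lt_two (by omega : 2 ≤ n)
  have hlogn : 0 < Real.log n := Real.log_pos (by exact_mod_cast (by omega : 1 < n))
  have hlog : M * Real.log 2 ≤ Real.log n := by
    rw [← Real.log_pow]
    exact Real.log_le_log (by positivity) (by exact_mod_cast Nat.pow_log_le_self 2 (by omega))
  have hgap : (Real.log 2) ^ 2 / 100 / (Real.log n) ^ 2 ≤ 1 / (100 * M ^ 2) := by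
    have h2 : (M * Real.log 2) ^ 2 ≤ (Real.log n) ^ 2 := by gcongr
    rw [div_div, div_le_div_iff₀ (by positivity) (by positivity)]
    nlinarith
  have hγ1 (k : ZMod n) : 1 ≤ 1 + (dyadicLevel k : ℝ) / (8 * M ^ 2) :=
    le_add_of_nonneg_right (by positivity)
  refine ⟨fun k => 1 + (dyadicLevel k : ℝ) / (8 * M ^ 2), fun k _ => by positivity,
    fun k hk => le_trans ?_ (sub_le_sub_left hgap 2)⟩
  beta_reduce
  set j := (2 : ZMod n)⁻¹ * k with hjdef
  have hjk : 2 * j = k := two_mul_inv_two_mul hodd k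
  have hj : j ≠ 0 := by
    rintro h
    exact hk (by rw [← hjk, h, mul_zero])
  have hfst : (1 + (dyadicLevel k : ℝ) / (8 * M ^ 2)) * |Real.cos (π * (k.val : ℕ) / n)| ≤
      1 + (dyadicLevel k : ℝ) / (8 * M ^ 2) :=
    mul_le_of_le_one_right (by positivity) (Real.abs_cos_le_one _)
  have hinv0 : 0 ≤ (1 + (dyadicLevel j : ℝ) / (8 * M ^ 2))⁻¹ := by positivity
  rcases le_or_gt (4 * circDist j) n with h | h
  · have hlevel := dyadicLevel_eq_succ hj h
    rw [hjk] at hlevel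
    have hle : (dyadicLevel k : ℝ) + 1 ≤ M := by
      rw [hMdef]
      exact_mod_cast hlevel ▸ dyadicLevel_le_log j
    have hstep := one_add_add_inv_le hM (Nat.cast_nonneg (dyadicLevel k)) hle
    have hcast : (dyadicLevel j : ℝ) = dyadicLevel k + 1 := by exact_mod_cast hlevel
    have hsnd := mul_le_of_le_one_right hinv0 (Real.abs_cos_le_one (π * (j.val : ℕ) / n))
    rw [hcast] at hsnd ⊢
    linarith
  · have hcos := abs_cos_le_of_lt_four_mul_circDist j h
    have hsnd := mul_le_mul (inv_le_one_of_one_le₀ (hγ1 j)) hcos (abs_nonneg _) zero_le_one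
    have hle : (dyadicLevel k : ℝ) ≤ M := by
      rw [hMdef]
      exact_mod_cast dyadicLevel_le_log k
    have hM2 : M ≤ M ^ 2 := by nlinarith
    have hsmall : (dyadicLevel k : ℝ) / (8 * M ^ 2) ≤ 1 / 8 := by
      rw [div_le_div_iff₀ (by positivity) (by norm_num)]
      linarith
    have hδ : 1 / (100 * M ^ 2) ≤ 1 / 100 := by
      rw [div_le_div_iff₀ (by positivity) (by norm_num)]
      nlinarith
    linarith
end

section
/- There exists an absolute constant C > 0 with the following property. Let n be an odd prime, y ∈ ℤ/nℤ with y ≠ 1, and define the three step maps f₀(x) = x + 1, f₁(x) = x + y, f₂(x) = 2x on ℤ/nℤ. For any nonempty subset S ⊆ ℤ/nℤ, any starting vertex v ∈ ℤ/nℤ, and any natural number r ≥ C·(log n)³, the number of sequences σ ∈ (Fin 3)^r such that applying f_{σ_{r-1}} ∘ ⋯ ∘ f_{σ_1} ∘ f_{σ_0} to v lands in S lies between (1/2)·3^r·|S|/n and (3/2)·3^r·|S|/n. -/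
open Finset Real

/-- The three step maps of the Pollard ρ graph on `ℤ/nℤ`:
`f₀(x) = x + 1`, `f₁(x) = x + y`, `f₂(x) = 2x`. -/
def pollardStep (n : ℕ) (y : ZMod n) : Fin 3 → ZMod n → ZMod n :=
  ![fun x => x + 1, fun x => x + y, fun x => 2 * x]

/-- The endpoint of the walk of length `r` from `v` determined by the step
sequence `σ`, applying `f_{σ 0}` first. -/
def pollardWalkEnd (n : ℕ) (y : ZMod n) (v : ZMod n) {r : ℕ} (σ : Fin r → Fin 3) : ZMod n :=
  (List.ofFn σ).foldl (fun x s => pollardStep n y s x) v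

/-- A nontrivial `n`-th root of unity is at distance at least `1 / n` from `1`. -/
lemma one_le_mul_norm_one_sub_of_pow_eq_one {n : ℕ} (hn : n ≠ 0) {z : ℂ} (hz : ‖z‖ = 1)
    (hzn : z ^ n = 1) (hz1 : z ≠ 1) : 1 ≤ n * ‖1 - z‖ := by
  have hgeom : ∑ m ∈ range n, z ^ m = 0 := by
    have h := geom_sum_mul z n
    rw [hzn, sub_self, mul_eq_zero] at h
    exact h.resolve_right (sub_ne_zero.2 hz1)
  have hpow : ∀ m : ℕ, ‖1 - z ^ m‖ ≤ m * ‖1 - z‖ := by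
    intro m
    induction m with
    | zero => simp
    | succ m ih =>
      have heq : 1 - z ^ (m + 1) = (1 - z ^ m) + z ^ m * (1 - z) := by ring
      rw [heq]
      refine (norm_add_le _ _).trans ?_
      rw [norm_mul, norm_pow, hz, one_pow]
      push_cast
      linarith
  have hsum : ∑ m ∈ range n, (1 - z ^ m) = n := by
    rw [sum_sub_distrib, hgeom]; simp
  have hle : (n : ℝ) ≤ n * (n * ‖1 - z‖) := by
    calc (n : ℝ) = ‖∑ m ∈ range n, (1 - z ^ m)‖ := by rw [hsum]; simp
      _ ≤ ∑ m ∈ range n, ‖1 - z ^ m‖ := norm_sum_le _ _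
      _ ≤ ∑ _m ∈ range n, (n : ℝ) * ‖1 - z‖ := by
        refine sum_le_sum fun m hm => (hpow m).trans ?_
        have : (m : ℝ) ≤ n := by exact_mod_cast (mem_range.1 hm).le
        gcongr
      _ = n * (n * ‖1 - z‖) := by simp
  have hpos : (0 : ℝ) < n := by positivity
  exact le_of_mul_le_mul_left (by linarith) hpos

lemma norm_one_sub_sq_of_norm_eq_one {z : ℂ} (hz : ‖z‖ = 1) : ‖1 - z‖ ^ 2 = 2 - 2 * z.re := by
  have h : z.re * z.re + z.im * z.im = 1 := by
    rw [← Complex.normSq_apply, Complex.normSq_eq_norm_sq, hz, one_pow]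
  rw [← Complex.normSq_eq_norm_sq, Complex.normSq_apply]
  simp only [Complex.sub_re, Complex.sub_im, Complex.one_re, Complex.one_im]
  linarith

lemma re_sq_of_norm_eq_one {z : ℂ} (hz : ‖z‖ = 1) : (z ^ 2).re = 2 * z.re ^ 2 - 1 := by
  have h : z.re * z.re + z.im * z.im = 1 := by
    rw [← Complex.normSq_apply, Complex.normSq_eq_norm_sq, hz, one_pow]
  rw [pow_two, Complex.mul_re]
  linarith

/-- Repeated squaring moves a nontrivial `n`-th root of unity into the left half plane within
about `2 log₂ n` steps. -/
lemma exists_re_pow_two_pow_nonpos {n T : ℕ} (hn : n ≠ 0) (hT : 2 * n ^ 2 ≤ 2 ^ T) {z : ℂ}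
    (hz : ‖z‖ = 1) (hzn : z ^ n = 1) (hz1 : z ≠ 1) : ∃ t ≤ T, (z ^ 2 ^ t).re ≤ 0 := by
  by_contra! hpos
  have hgrow : ∀ t ≤ T, 2 ^ t * (1 - z.re) ≤ 1 - (z ^ 2 ^ t).re := by
    intro t
    induction t with
    | zero => simp
    | succ t ih =>
      intro ht
      have h1 := ih (by omega)
      have h2 := hpos t (by omega)
      have hnorm : ‖z ^ 2 ^ t‖ = 1 := by rw [norm_pow, hz, one_pow]
      have h3 : (z ^ 2 ^ t).re ≤ 1 := hnorm ▸ Complex.re_le_norm _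
      have h4 : (z ^ 2 ^ (t + 1)).re = 2 * (z ^ 2 ^ t).re ^ 2 - 1 := by
        rw [pow_succ 2 t, pow_mul, re_sq_of_norm_eq_one hnorm]
      rw [h4, pow_succ]
      nlinarith
  have h1 := hgrow T le_rfl
  have h2 := hpos T le_rfl
  have h3 := one_le_mul_norm_one_sub_of_pow_eq_one hn hz hzn hz1
  have h4 := norm_one_sub_sq_of_norm_eq_one hz
  have h5 : 1 ≤ ((n : ℝ) * ‖1 - z‖) ^ 2 := one_le_pow₀ h3
  rw [mul_pow, h4] at h5
  have h6 : (2 * n ^ 2 : ℝ) ≤ 2 ^ T := by exact_mod_cast hT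
  have h7 : 0 ≤ 1 - z.re := by
    have : z.re ≤ 1 := hz ▸ Complex.re_le_norm _
    linarith
  nlinarith [mul_le_mul_of_nonneg_right h6 h7]

/-- The number of squarings needed to move `z` into the left half plane. -/
noncomputable def squaringDepth (z : ℂ) : ℕ := sInf {t | (z ^ 2 ^ t).re ≤ 0}

lemma squaringDepth_le {T : ℕ} {z : ℂ} (h : ∃ t ≤ T, (z ^ 2 ^ t).re ≤ 0) :
    squaringDepth z ≤ T := by
  obtain ⟨t, htT, ht⟩ := h
  exact (Nat.sInf_le ht).trans htT

lemma squaringDepth_sq_add_one_le {z : ℂ} (hz : 0 < z.re) (h : ∃ t, (z ^ 2 ^ t).re ≤ 0) :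
    squaringDepth (z ^ 2) + 1 ≤ squaringDepth z := by
  have hmem : (z ^ 2 ^ squaringDepth z).re ≤ 0 := Nat.sInf_mem (s := {t | (z ^ 2 ^ t).re ≤ 0}) h
  cases hd : squaringDepth z with
  | zero => simp [hd] at hmem; linarith
  | succ t =>
    rw [hd, pow_succ', pow_mul] at hmem
    exact Nat.succ_le_succ (Nat.sInf_le hmem)

/-- The weight `4 T + squaringDepth z` is contracted by the transfer operator. -/
lemma norm_one_add_mul_weight_add_weight_sq_le {T : ℕ} (hT : 0 < T) {z : ℂ} (hz : ‖z‖ = 1)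
    (h : ∃ t ≤ T, (z ^ 2 ^ t).re ≤ 0) (hsq : ∃ t ≤ T, ((z ^ 2) ^ 2 ^ t).re ≤ 0) :
    ‖1 + z‖ * (4 * T + squaringDepth z) + (4 * T + squaringDepth (z ^ 2)) ≤
      (3 - 1 / (5 * T)) * (4 * T + squaringDepth z : ℝ) := by
  have hT1 : (1 : ℝ) ≤ T := by exact_mod_cast hT
  have hd : (squaringDepth z : ℝ) ≤ T := by exact_mod_cast squaringDepth_le h
  have hd0 : (0 : ℝ) ≤ squaringDepth z := by positivity
  have hd2 : (squaringDepth (z ^ 2) : ℝ) ≤ T := by exact_mod_cast squaringDepth_le hsq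
  have hgap : 1 / (5 * T) * (4 * T + squaringDepth z : ℝ) ≤ 1 := by
    rw [div_mul_eq_mul_div, div_le_one (by positivity)]
    linarith
  rcases le_or_gt z.re 0 with hre | hre
  · have hnorm : ‖1 + z‖ ≤ 3 / 2 := by
      have h1 := norm_one_sub_sq_of_norm_eq_one (z := -z) (by rwa [norm_neg])
      rw [sub_neg_eq_add, Complex.neg_re] at h1
      nlinarith [norm_nonneg (1 + z)]
    nlinarith
  · have hnorm : ‖1 + z‖ ≤ 2 := by
      have := norm_add_le 1 z
      rw [hz, norm_one] at this
      linarith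
    have h1 : (squaringDepth (z ^ 2) + 1 : ℝ) ≤ squaringDepth z := by
      exact_mod_cast squaringDepth_sq_add_one_le hre (h.imp fun _ ht => ht.2)
    nlinarith

lemma pollardWalkEnd_snoc (n : ℕ) (y v : ZMod n) {r : ℕ} (σ : Fin r → Fin 3) (s : Fin 3) :
    pollardWalkEnd n y v (Fin.snoc σ s : Fin (r + 1) → Fin 3) =
      pollardStep n y s (pollardWalkEnd n y v σ) := by
  rw [pollardWalkEnd, List.ofFn_succ_last, List.foldl_append]
  simp [pollardWalkEnd]

/-- Summing a function of the endpoint over all walks, split according to the last step. -/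
lemma sum_pollardWalkEnd_succ {M : Type*} [AddCommMonoid M] (n : ℕ) (y v : ZMod n) (r : ℕ)
    (F : ZMod n → M) :
    ∑ σ : Fin (r + 1) → Fin 3, F (pollardWalkEnd n y v σ) =
      ∑ σ : Fin r → Fin 3, (F (pollardWalkEnd n y v σ + 1) + F (pollardWalkEnd n y v σ + y) +
        F (2 * pollardWalkEnd n y v σ)) := by
  rw [← (Fin.snocEquiv fun _ : Fin (r + 1) => Fin 3).sum_comp, Fintype.sum_prod_type_right]
  refine sum_congr rfl fun σ _ => ?_
  simp only [Fin.snocEquiv, Equiv.coe_fn_mk, Fin.sum_univ_three]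
  erw [pollardWalkEnd_snoc, pollardWalkEnd_snoc, pollardWalkEnd_snoc]
  rfl

lemma norm_sum_stdAddChar_pollardWalkEnd_mul_le {n : ℕ} [Fact n.Prime] (hodd : Odd n)
    {y : ZMod n} (hy : y ≠ 1) (v : ZMod n) {T : ℕ} (hT0 : 0 < T) (hT : 2 * n ^ 2 ≤ 2 ^ T)
    (r : ℕ) {k : ZMod n} (hk : k ≠ 0) :
    ‖∑ σ : Fin r → Fin 3, ZMod.stdAddChar (k * pollardWalkEnd n y v σ)‖ * (4 * T) ≤
      (3 - 1 / (5 * T)) ^ r * (4 * T + squaringDepth (ZMod.stdAddChar (k * (y - 1))) : ℝ) := by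
  have hT1 : (1 : ℝ) ≤ T := by exact_mod_cast hT0
  have hrate : (0 : ℝ) ≤ 3 - 1 / (5 * T) := by
    have : 1 / (5 * T : ℝ) ≤ 1 := by rw [div_le_one (by positivity)]; linarith
    linarith
  have h2 : (2 : ZMod n) ≠ 0 := by
    intro h
    have hdvd : n ∣ 2 := (ZMod.natCast_eq_zero_iff 2 n).1 (by exact_mod_cast h)
    obtain ⟨m, rfl⟩ := hodd
    have := Nat.le_of_dvd two_pos hdvd
    have := (Fact.out : (2 * m + 1).Prime).one_lt
    omega
  have hnorm : ∀ x : ZMod n, ‖ZMod.stdAddChar x‖ = 1 := fun x => by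
    rw [ZMod.stdAddChar_apply, Circle.norm_coe]
  have hreach : ∀ x : ZMod n, x ≠ 0 → ∃ t ≤ T, (ZMod.stdAddChar x ^ 2 ^ t).re ≤ 0 := by
    intro x hx
    refine exists_re_pow_two_pow_nonpos (NeZero.ne n) hT (hnorm x) ?_ ?_
    · rw [← AddChar.map_nsmul_eq_pow]; simp
    · rw [← (ZMod.stdAddChar (N := n)).map_zero_eq_one]
      exact ZMod.injective_stdAddChar.ne hx
  induction r generalizing k with
  | zero => simp [hnorm]
  | succ r ih =>
    have hk2 : k * 2 ≠ 0 := mul_ne_zero hk h2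
    have hx : k * (y - 1) ≠ 0 := mul_ne_zero hk (sub_ne_zero.2 hy)
    have hsq : ZMod.stdAddChar (k * 2 * (y - 1)) = ZMod.stdAddChar (k * (y - 1)) ^ 2 := by
      rw [← AddChar.map_nsmul_eq_pow]
      congr 1
      rw [nsmul_eq_mul]; push_cast; ring
    have hrec : ∑ σ : Fin (r + 1) → Fin 3, ZMod.stdAddChar (k * pollardWalkEnd n y v σ) =
        ZMod.stdAddChar k * (1 + ZMod.stdAddChar (k * (y - 1))) *
          (∑ σ : Fin r → Fin 3, ZMod.stdAddChar (k * pollardWalkEnd n y v σ)) +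
        ∑ σ : Fin r → Fin 3, ZMod.stdAddChar (k * 2 * pollardWalkEnd n y v σ) := by
      rw [sum_pollardWalkEnd_succ n y v r fun x => ZMod.stdAddChar (k * x), mul_sum,
        ← sum_add_distrib]
      refine sum_congr rfl fun σ _ => ?_
      rw [mul_add, mul_add, AddChar.map_add_eq_mul, AddChar.map_add_eq_mul, mul_one, mul_assoc k 2]
      have hy' : k * y = k + k * (y - 1) := by ring
      rw [hy', AddChar.map_add_eq_mul]
      ring
    have hcontr := norm_one_add_mul_weight_add_weight_sq_le hT0 (hnorm (k * (y - 1)))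
      (hreach _ hx) (by
        rw [← hsq]
        exact hreach _ (mul_ne_zero hk2 (sub_ne_zero.2 hy)))
    have ih1 := ih hk
    have ih2 := ih hk2
    rw [hsq] at ih2
    rw [hrec]
    set z := ZMod.stdAddChar (k * (y - 1))
    set E := ∑ σ : Fin r → Fin 3, ZMod.stdAddChar (k * pollardWalkEnd n y v σ)
    set E' := ∑ σ : Fin r → Fin 3, ZMod.stdAddChar (k * 2 * pollardWalkEnd n y v σ)
    calc ‖ZMod.stdAddChar k * (1 + z) * E + E'‖ * (4 * T)
        ≤ (‖1 + z‖ * ‖E‖ + ‖E'‖) * (4 * T) := by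
          gcongr
          refine (norm_add_le _ _).trans ?_
          rw [norm_mul, norm_mul, hnorm, one_mul]
      _ = ‖1 + z‖ * (‖E‖ * (4 * T)) + ‖E'‖ * (4 * T) := by ring
      _ ≤ ‖1 + z‖ * ((3 - 1 / (5 * T)) ^ r * (4 * T + squaringDepth z)) +
          (3 - 1 / (5 * T)) ^ r * (4 * T + squaringDepth (z ^ 2)) := by gcongr
      _ = (3 - 1 / (5 * T)) ^ r *
          (‖1 + z‖ * (4 * T + squaringDepth z) + (4 * T + squaringDepth (z ^ 2))) := by ring
      _ ≤ (3 - 1 / (5 * T)) ^ r * ((3 - 1 / (5 * T)) * (4 * T + squaringDepth z)) := by gcongr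
      _ = (3 - 1 / (5 * T)) ^ (r + 1) * (4 * T + squaringDepth z) := by ring

/-- The nontrivial Fourier coefficients of the endpoint distribution decay exponentially. -/
lemma norm_sum_stdAddChar_pollardWalkEnd_le {n : ℕ} [Fact n.Prime] (hodd : Odd n)
    {y : ZMod n} (hy : y ≠ 1) (v : ZMod n) {T : ℕ} (hT0 : 0 < T) (hT : 2 * n ^ 2 ≤ 2 ^ T)
    (r : ℕ) {k : ZMod n} (hk : k ≠ 0) :
    ‖∑ σ : Fin r → Fin 3, ZMod.stdAddChar (k * pollardWalkEnd n y v σ)‖ ≤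
      5 / 4 * (3 - 1 / (5 * T) : ℝ) ^ r := by
  have hT1 : (1 : ℝ) ≤ T := by exact_mod_cast hT0
  have hrate : (0 : ℝ) ≤ 3 - 1 / (5 * T) := by
    have : 1 / (5 * T : ℝ) ≤ 1 := by rw [div_le_one (by positivity)]; linarith
    linarith
  have h := norm_sum_stdAddChar_pollardWalkEnd_mul_le hodd hy v hT0 hT r hk
  have hd : (squaringDepth (ZMod.stdAddChar (k * (y - 1))) : ℝ) ≤ T := by
    refine Nat.cast_le.2 (squaringDepth_le (exists_re_pow_two_pow_nonpos (NeZero.ne n) hT ?_ ?_ ?_))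
    · rw [ZMod.stdAddChar_apply, Circle.norm_coe]
    · rw [← AddChar.map_nsmul_eq_pow]; simp
    · rw [← (ZMod.stdAddChar (N := n)).map_zero_eq_one]
      exact ZMod.injective_stdAddChar.ne (mul_ne_zero hk (sub_ne_zero.2 hy))
  refine le_of_mul_le_mul_right (h.trans ?_) (by positivity : (0 : ℝ) < 4 * T)
  have := mul_le_mul_of_nonneg_left hd (pow_nonneg hrate r)
  linarith

/-- If all nontrivial character sums of `X` are at most `B`, then `X` hits a set `S` with
frequency `|S| / n`, up to an error `|S| * B`. -/
lemma abs_card_filter_sub_le_of_norm_sum_stdAddChar_le {n : ℕ} [NeZero n] [Nontrivial (ZMod n)]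
    {ι : Type*} [Fintype ι]
    (X : ι → ZMod n) (S : Finset (ZMod n)) {B : ℝ}
    (hB : ∀ k : ZMod n, k ≠ 0 → ‖∑ i, ZMod.stdAddChar (k * X i)‖ ≤ B) :
    |(n : ℝ) * (univ.filter fun i => X i ∈ S).card - Fintype.card ι * S.card| ≤
      n * (S.card * B) := by
  have horth : ∀ a : ZMod n,
      ∑ k : ZMod n, ZMod.stdAddChar (k * a) = if a = 0 then (n : ℂ) else 0 := by
    intro a
    rw [AddChar.sum_mulShift a (ZMod.isPrimitive_stdAddChar n), ZMod.card]
    simp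
  have hcount : (n : ℂ) * (univ.filter fun i => X i ∈ S).card =
      ∑ k : ZMod n, (∑ s ∈ S, ZMod.stdAddChar (-(k * s))) * ∑ i, ZMod.stdAddChar (k * X i) := by
    have h1 : ∀ i, (if X i ∈ S then (n : ℂ) else 0) =
        ∑ s ∈ S, ∑ k : ZMod n, ZMod.stdAddChar (k * (X i - s)) := by
      intro i
      simp_rw [horth, sub_eq_zero]
      rw [sum_ite_eq]
    calc (n : ℂ) * (univ.filter fun i => X i ∈ S).card
        = ∑ i, if X i ∈ S then (n : ℂ) else 0 := by
          rw [← sum_filter, sum_const, nsmul_eq_mul, mul_comm]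
      _ = ∑ i, ∑ s ∈ S, ∑ k : ZMod n, ZMod.stdAddChar (k * (X i - s)) := by simp_rw [h1]
      _ = ∑ i, ∑ k : ZMod n, ∑ s ∈ S, ZMod.stdAddChar (k * (X i - s)) :=
          sum_congr rfl fun _ _ => sum_comm
      _ = ∑ k : ZMod n, ∑ i, ∑ s ∈ S, ZMod.stdAddChar (k * (X i - s)) := sum_comm
      _ = _ := by
          refine sum_congr rfl fun k _ => ?_
          rw [mul_comm, sum_mul_sum]
          refine sum_congr rfl fun i _ => sum_congr rfl fun s _ => ?_
          rw [← AddChar.map_add_eq_mul]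
          congr 1
          ring
  have hdiff :
      (((n : ℝ) * (univ.filter fun i => X i ∈ S).card - Fintype.card ι * S.card : ℝ) : ℂ) =
      ∑ k ∈ univ.erase (0 : ZMod n),
        (∑ s ∈ S, ZMod.stdAddChar (-(k * s))) * ∑ i, ZMod.stdAddChar (k * X i) := by
    push_cast
    rw [hcount, ← add_sum_erase _ _ (mem_univ (0 : ZMod n))]
    simp
    ring
  rw [← Real.norm_eq_abs, ← Complex.norm_real, hdiff]
  have hterm : ∀ k ∈ univ.erase (0 : ZMod n),
      ‖(∑ s ∈ S, ZMod.stdAddChar (-(k * s))) * ∑ i, ZMod.stdAddChar (k * X i)‖ ≤ S.card * B := by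
    intro k hk
    rw [norm_mul]
    refine mul_le_mul ?_ (hB k (ne_of_mem_erase hk)) (norm_nonneg _) (by positivity)
    refine (norm_sum_le _ _).trans ?_
    simp only [ZMod.stdAddChar_apply, Circle.norm_coe, sum_const, nsmul_eq_mul, mul_one, le_refl]
  have hSB : 0 ≤ S.card * B := (norm_nonneg _).trans (hterm 1 (by simp))
  refine (norm_sum_le_of_le _ hterm).trans ?_
  rw [sum_const, nsmul_eq_mul]
  gcongr
  simp

lemma clog_two_mul_sq_le {n : ℕ} (hn : 3 ≤ n) : (Nat.clog 2 (2 * n ^ 2) : ℝ) ≤ 5 * Real.log n := by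
  have hlog1 : 1 ≤ Real.log n := by
    rw [Real.le_log_iff_exp_le (by positivity)]
    have : (3 : ℝ) ≤ n := by exact_mod_cast hn
    linarith [Real.exp_one_lt_d9]
  have hgt : 1 < 2 * n ^ 2 := by nlinarith
  have h1 : 2 ^ (Nat.clog 2 (2 * n ^ 2)).pred < 2 * n ^ 2 := Nat.pow_pred_clog_lt_self one_lt_two hgt
  have hpos : 0 < Nat.clog 2 (2 * n ^ 2) := Nat.clog_pos one_lt_two hgt
  obtain ⟨m, hm⟩ := Nat.exists_eq_succ_of_ne_zero hpos.ne'
  rw [hm] at h1 ⊢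
  have h2 : (2 : ℝ) ^ m ≤ 2 * (n : ℝ) ^ 2 := by exact_mod_cast h1.le
  have h3 := Real.log_le_log (by positivity) h2
  have hn0 : (n : ℝ) ≠ 0 := by positivity
  rw [Real.log_pow, Real.log_mul two_ne_zero (by positivity), Real.log_pow] at h3
  push_cast at h3 ⊢
  have h4 := Real.log_two_gt_d9
  by_contra! hcon
  nlinarith

/-- Exponential decay at rate `1 / (15 T)` beats `n` after `O(log² n)` steps. -/
lemma mixing_error_le {n T r : ℕ} (hn : 3 ≤ n) (hT0 : 0 < T) (hT : (T : ℝ) ≤ 5 * Real.log n)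
    (hr : 150 * (Real.log n) ^ 3 ≤ r) :
    n * (5 / 4 * (3 - 1 / (5 * T) : ℝ) ^ r) ≤ 1 / 2 * 3 ^ r := by
  have hn3 : (3 : ℝ) ≤ n := by exact_mod_cast hn
  have hlog1 : 1 ≤ Real.log n := by
    rw [Real.le_log_iff_exp_le (by positivity)]
    linarith [Real.exp_one_lt_d9]
  have hT1 : (1 : ℝ) ≤ T := by exact_mod_cast hT0
  set x : ℝ := 1 / (15 * T) with hx
  have hx1 : x ≤ 1 := by rw [hx, div_le_one (by positivity)]; linarith
  have hrx : 2 * Real.log n ≤ r * x := by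
    rw [hx, mul_one_div, le_div_iff₀ (by positivity)]
    nlinarith [mul_le_mul_of_nonneg_left hT (by positivity : 0 ≤ Real.log n),
      mul_le_mul_of_nonneg_left hlog1 (by positivity : 0 ≤ Real.log n ^ 2)]
  have hdecay : (1 - x) ^ r ≤ ((n : ℝ) ^ 2)⁻¹ := by
    calc (1 - x) ^ r ≤ Real.exp (-x) ^ r :=
          pow_le_pow_left₀ (by linarith) (Real.one_sub_le_exp_neg x) r
      _ = Real.exp (-(r * x)) := by rw [← Real.exp_nat_mul]; congr 1; ring
      _ ≤ Real.exp (-(2 * Real.log n)) := Real.exp_le_exp.2 (by linarith)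
      _ = ((n : ℝ) ^ 2)⁻¹ := by
        rw [Real.exp_neg, two_mul, Real.exp_add, Real.exp_log (by positivity), pow_two]
  have hfac : (3 - 1 / (5 * T) : ℝ) = 3 * (1 - x) := by rw [hx]; field_simp; ring
  rw [hfac, mul_pow]
  have hmain : n * (5 / 4 * (1 - x) ^ r) ≤ 1 / 2 := by
    calc n * (5 / 4 * (1 - x) ^ r) ≤ n * (5 / 4 * ((n : ℝ) ^ 2)⁻¹) := by gcongr
      _ = 5 / 4 / n := by field_simp
      _ ≤ 1 / 2 := by rw [div_le_iff₀ (by positivity)]; linarith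
  nlinarith [mul_le_mul_of_nonneg_right hmain (by positivity : (0 : ℝ) ≤ 3 ^ r)]

/-- **Rapid mixing of the Pollard ρ graph.**
There is an absolute constant `C > 0` such that for every odd prime `n`, every
`y ≠ 1` in `ℤ/nℤ`, every nonempty `S ⊆ ℤ/nℤ`, every starting vertex `v` and every
`r ≥ C (log n)³`, the number of walks of length `r` from `v` ending in `S` lies
between `(1/2)·3^r·|S|/n` and `(3/2)·3^r·|S|/n`. -/
theorem pollard_rho_rapid_mixing :
    ∃ C : ℝ, 0 < C ∧ ∀ n : ℕ, n.Prime → Odd n → ∀ y : ZMod n, y ≠ 1 →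
      ∀ S : Finset (ZMod n), S.Nonempty → ∀ v : ZMod n, ∀ r : ℕ,
        C * (Real.log n) ^ 3 ≤ (r : ℝ) →
          (1 / 2 : ℝ) * 3 ^ r * S.card / n ≤
              ((Finset.univ.filter
                  (fun σ : Fin r → Fin 3 => pollardWalkEnd n y v σ ∈ S)).card : ℝ) ∧
            ((Finset.univ.filter
                (fun σ : Fin r → Fin 3 => pollardWalkEnd n y v σ ∈ S)).card : ℝ) ≤
              (3 / 2 : ℝ) * 3 ^ r * S.card / n := by
  refine ⟨150, by norm_num, fun n hp hodd y hy S _ v r hr => ?_⟩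
  have : Fact n.Prime := ⟨hp⟩
  have hn : 3 ≤ n := by
    have := hp.two_le
    obtain ⟨m, rfl⟩ := hodd
    omega
  have hT0 : 0 < Nat.clog 2 (2 * n ^ 2) := Nat.clog_pos one_lt_two (by nlinarith)
  have herr := abs_card_filter_sub_le_of_norm_sum_stdAddChar_le
    (fun σ : Fin r → Fin 3 => pollardWalkEnd n y v σ) S fun k hk =>
      norm_sum_stdAddChar_pollardWalkEnd_le hodd hy v hT0 (Nat.le_pow_clog one_lt_two _) r hk
  have hsmall := mul_le_mul_of_nonneg_left
    (mixing_error_le hn hT0 (clog_two_mul_sq_le hn) hr) (Nat.cast_nonneg (α := ℝ) S.card)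
  have hcard : ((Fintype.card (Fin r → Fin 3) : ℕ) : ℝ) = 3 ^ r := by simp
  rw [hcard, abs_le] at herr
  have hn0 : (0 : ℝ) < n := by positivity
  rw [div_le_iff₀ hn0, le_div_iff₀ hn0]
  constructor <;> linarith [herr.1, herr.2]
end

section
/- For every ε > 0 there exists a constant C > 0 with the following property. Let n be an odd prime, y ∈ ℤ/nℤ with y ≠ 1, and define the step maps f₀(x) = x + 1, f₁(x) = x + y, f₂(x) = 2x on ℤ/nℤ. For any starting point x₀ ∈ ℤ/nℤ and any natural number N ≥ C·√n·(log n)³, the number of sequences σ ∈ (Fin 3)^N for which the walk x_{i+1} = f_{σ_i}(x_i), i = 0, …, N−1, has all of x₀, x₁, …, x_N pairwise distinct (i.e., no collision occurs) is at most ε·3^N. In other words, the uniform random walk on the Pollard ρ graph started at x₀ produces a collision among its first N iterates with probability at least 1 − ε. -/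
open Finset Real

/-- The `i`-th iterate `x_i` of the walk from `x₀` determined by the step sequence
`σ`, i.e. the result of applying `f_{σ 0}, f_{σ 1}, …, f_{σ (i-1)}` in order. -/
def pollardWalk (n : ℕ) (y : ZMod n) (x₀ : ZMod n) {N : ℕ} (σ : Fin N → Fin 3) (i : ℕ) :
    ZMod n :=
  ((List.ofFn σ).take i).foldl (fun x s => pollardStep n y s x) x₀

section Walk

variable {n : ℕ} {y : ZMod n}

lemma pollardWalk_append_of_le (x : ZMod n) {a b : ℕ} (σ : Fin a → Fin 3) (τ : Fin b → Fin 3)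
    {i : ℕ} (hi : i ≤ a) :
    pollardWalk n y x (Fin.append σ τ) i = pollardWalk n y x σ i := by
  simp [pollardWalk, List.ofFn_fin_append, List.take_append_of_le_length, hi]

lemma pollardWalk_append_add (x : ZMod n) {a b : ℕ} (σ : Fin a → Fin 3) (τ : Fin b → Fin 3)
    (i : ℕ) :
    pollardWalk n y x (Fin.append σ τ) (a + i) =
      pollardWalk n y (pollardWalk n y x σ a) τ i := by
  simp [pollardWalk, List.ofFn_fin_append, List.take_append, List.take_of_length_le]

lemma pollardWalk_one (x : ZMod n) (σ : Fin 1 → Fin 3) :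
    pollardWalk n y x σ 1 = pollardStep n y (σ 0) x := by
  simp [pollardWalk]

lemma sum_fin_add {M : Type*} [AddCommMonoid M] {α : Type*} [Fintype α] (a b : ℕ)
    (g : (Fin (a + b) → α) → M) :
    ∑ σ, g σ = ∑ σ : Fin a → α, ∑ τ : Fin b → α, g (Fin.append σ τ) := by
  rw [← (Fin.appendEquiv a b).sum_comp, Fintype.sum_prod_type]
  rfl

lemma sum_pollardWalk_succ {M : Type*} [AddCommMonoid M] (x : ZMod n) (t : ℕ)
    (g : ZMod n → M) :
    ∑ σ : Fin (t + 1) → Fin 3, g (pollardWalk n y x σ (t + 1)) =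
      ∑ σ : Fin t → Fin 3, (g (pollardWalk n y x σ t + 1) + g (pollardWalk n y x σ t + y) +
        g (2 * pollardWalk n y x σ t)) := by
  rw [sum_fin_add]
  refine Finset.sum_congr rfl fun σ _ => ?_
  simp only [pollardWalk_append_add, pollardWalk_one]
  rw [← (Equiv.funUnique (Fin 1) (Fin 3)).symm.sum_comp, Fin.sum_univ_three]
  rfl

end Walk

section Character

variable {n : ℕ}

/-- A potential on `ℤ/nℤ` that drops by one under each doubling of a residue close to `0`. -/
noncomputable def doublingWeight (r : ZMod n) : ℝ :=
  4 * (Nat.log 2 n : ℝ) - Nat.log 2 r.valMinAbs.natAbs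

lemma doublingWeight_le (r : ZMod n) : doublingWeight r ≤ 4 * (Nat.log 2 n : ℝ) := by
  unfold doublingWeight
  have : (0 : ℝ) ≤ Nat.log 2 r.valMinAbs.natAbs := Nat.cast_nonneg _
  linarith

variable [NeZero n]

lemma norm_one_add_stdAddChar_le_two (r : ZMod n) : ‖1 + ZMod.stdAddChar r‖ ≤ 2 := by
  have := norm_add_le (1 : ℂ) (ZMod.stdAddChar r)
  rw [AddChar.norm_apply, norm_one] at this
  linarith

/-- Residues far from `0` have characters in the left half plane. -/
lemma norm_one_add_stdAddChar_le {r : ZMod n} (hr : n ≤ 4 * r.valMinAbs.natAbs) :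
    ‖1 + ZMod.stdAddChar r‖ ≤ 3 / 2 := by
  have hn : (0 : ℝ) < n := Nat.cast_pos.2 (NeZero.pos n)
  have hpi := Real.pi_pos
  set θ : ℝ := 2 * π * r.valMinAbs / n with hθ
  have hψ : ZMod.stdAddChar r = Complex.exp (θ * Complex.I) := by
    conv_lhs => rw [← ZMod.coe_valMinAbs r]
    rw [ZMod.stdAddChar_coe, hθ]
    congr 1
    push_cast
    ring
  have habs : |θ| = 2 * π * (r.valMinAbs.natAbs : ℝ) / n := by
    rw [hθ, abs_div, abs_mul, abs_of_pos hn, abs_of_pos (by positivity : 0 < 2 * π),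
      Nat.cast_natAbs, Int.cast_abs]
  have hlow : (n : ℝ) ≤ 4 * r.valMinAbs.natAbs := by exact_mod_cast hr
  have hup : 2 * (r.valMinAbs.natAbs : ℝ) ≤ n := by
    have := ZMod.natAbs_valMinAbs_le r
    exact_mod_cast (by omega : 2 * r.valMinAbs.natAbs ≤ n)
  have hcos : Real.cos θ ≤ 0 := by
    rw [← Real.cos_abs]
    refine Real.cos_nonpos_of_pi_div_two_le_of_le ?_ ?_
    · rw [habs, le_div_iff₀ hn]; nlinarith
    · rw [habs, div_le_iff₀ hn]; nlinarith
  have hsq : ‖1 + ZMod.stdAddChar r‖ ^ 2 = 2 + 2 * Real.cos θ := by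
    rw [hψ, Complex.sq_norm, Complex.normSq_apply]
    simp only [Complex.add_re, Complex.one_re, Complex.add_im, Complex.one_im,
      Complex.exp_ofReal_mul_I_re, Complex.exp_ofReal_mul_I_im]
    nlinarith [Real.sin_sq_add_cos_sq θ]
  nlinarith [norm_nonneg (1 + ZMod.stdAddChar r)]

lemma natAbs_valMinAbs_two_mul {r : ZMod n} (hr : 4 * r.valMinAbs.natAbs < n) :
    (2 * r).valMinAbs.natAbs = 2 * r.valMinAbs.natAbs := by
  have h : (2 * r).valMinAbs = 2 * r.valMinAbs := by
    rw [ZMod.valMinAbs_spec]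
    refine ⟨by push_cast [ZMod.coe_valMinAbs]; rfl, ?_⟩
    rw [Set.mem_Ioc]
    omega
  rw [h, Int.natAbs_mul]
  rfl

lemma le_doublingWeight (r : ZMod n) : 3 * (Nat.log 2 n : ℝ) ≤ doublingWeight r := by
  unfold doublingWeight
  have h : Nat.log 2 r.valMinAbs.natAbs ≤ Nat.log 2 n :=
    Nat.log_mono_right ((ZMod.natAbs_valMinAbs_le r).trans (Nat.div_le_self _ _))
  have : (Nat.log 2 r.valMinAbs.natAbs : ℝ) ≤ Nat.log 2 n := by exact_mod_cast h
  linarith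

lemma doublingWeight_contraction (hn : 1 ≤ Nat.log 2 n) {r : ZMod n} (hr : r ≠ 0) :
    ‖1 + ZMod.stdAddChar r‖ * doublingWeight r + doublingWeight (2 * r) ≤
      3 * (1 - 1 / (24 * (Nat.log 2 n : ℝ))) * doublingWeight r := by
  set L : ℝ := (Nat.log 2 n : ℝ) with hL
  have hL1 : 1 ≤ L := by rw [hL]; exact_mod_cast hn
  have hlow := le_doublingWeight r
  have hup := doublingWeight_le r
  have hsmall : 1 / (24 * L) * doublingWeight r ≤ 1 / 6 := by
    rw [div_mul_eq_mul_div, div_le_iff₀ (by positivity)]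
    linarith
  by_cases h : n ≤ 4 * r.valMinAbs.natAbs
  · have h1 := norm_one_add_stdAddChar_le h
    have h2 := doublingWeight_le (2 * r)
    nlinarith
  · push Not at h
    have h1 := norm_one_add_stdAddChar_le_two r
    have h2 : doublingWeight (2 * r) = doublingWeight r - 1 := by
      have h0 : r.valMinAbs.natAbs ≠ 0 := by simpa using hr
      unfold doublingWeight
      rw [natAbs_valMinAbs_two_mul h, mul_comm 2, Nat.log_mul_base one_lt_two h0]
      push_cast
      ring
    nlinarith

end Character

section Mixing

variable {n : ℕ} {y : ZMod n}

lemma norm_sum_stdAddChar_pollardWalk_le [Fact n.Prime] (hodd : Odd n) (hy : y ≠ 1)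
    (x : ZMod n) (t : ℕ) {k : ZMod n} (hk : k ≠ 0) :
    3 * (Nat.log 2 n : ℝ) *
        ‖∑ σ : Fin t → Fin 3, ZMod.stdAddChar (k * pollardWalk n y x σ t)‖ ≤
      (3 * (1 - 1 / (24 * (Nat.log 2 n : ℝ)))) ^ t * doublingWeight (k * (y - 1)) := by
  have hn : 1 ≤ Nat.log 2 n := Nat.log_pos one_lt_two (Fact.out : n.Prime).two_le
  have h2 : (2 : ZMod n) ≠ 0 := by
    refine Ring.two_ne_zero ?_
    rw [ZMod.ringChar_zmod_n]
    rintro rfl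
    exact absurd hodd (by decide)
  have hL : (1 : ℝ) ≤ Nat.log 2 n := by exact_mod_cast hn
  induction t generalizing k with
  | zero => simpa [AddChar.norm_apply] using le_doublingWeight (k * (y - 1))
  | succ t ih =>
    have key : ∑ σ : Fin (t + 1) → Fin 3, ZMod.stdAddChar (k * pollardWalk n y x σ (t + 1)) =
        ZMod.stdAddChar k * (1 + ZMod.stdAddChar (k * (y - 1))) *
          ∑ σ : Fin t → Fin 3, ZMod.stdAddChar (k * pollardWalk n y x σ t) +
        ∑ σ : Fin t → Fin 3, ZMod.stdAddChar (2 * k * pollardWalk n y x σ t) := by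
      rw [sum_pollardWalk_succ x t fun z => ZMod.stdAddChar (k * z), Finset.mul_sum,
        ← Finset.sum_add_distrib]
      refine Finset.sum_congr rfl fun σ _ => ?_
      rw [show k * (2 * pollardWalk n y x σ t) = 2 * k * pollardWalk n y x σ t by ring,
        mul_add (ZMod.stdAddChar k), ← AddChar.map_add_eq_mul, mul_one, add_mul,
        ← AddChar.map_add_eq_mul, ← AddChar.map_add_eq_mul]
      congr 4 <;> ring
    have ih1 := ih hk
    have ih2 := ih (mul_ne_zero h2 hk)
    have hr : k * (y - 1) ≠ 0 := mul_ne_zero hk (sub_ne_zero.2 hy)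
    have hc := doublingWeight_contraction hn hr
    rw [mul_assoc 2 k] at ih2
    set ρ : ℝ := 3 * (1 - 1 / (24 * (Nat.log 2 n : ℝ))) with hρ
    have hρ0 : 0 ≤ ρ := by
      have : 1 / (24 * (Nat.log 2 n : ℝ)) ≤ 1 := by
        rw [div_le_one (by positivity)]; linarith
      rw [hρ]; linarith
    set A := ‖∑ σ : Fin t → Fin 3, ZMod.stdAddChar (k * pollardWalk n y x σ t)‖ with hA
    set B := ‖∑ σ : Fin t → Fin 3, ZMod.stdAddChar (2 * k * pollardWalk n y x σ t)‖ with hB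
    set c := ‖1 + ZMod.stdAddChar (k * (y - 1))‖ with hcdef
    have hnorm : ‖∑ σ : Fin (t + 1) → Fin 3,
        ZMod.stdAddChar (k * pollardWalk n y x σ (t + 1))‖ ≤ c * A + B := by
      rw [key]
      refine (norm_add_le _ _).trans ?_
      rw [norm_mul, norm_mul, AddChar.norm_apply, one_mul]
    calc _ ≤ 3 * (Nat.log 2 n : ℝ) * (c * A + B) := by gcongr
      _ = c * (3 * (Nat.log 2 n : ℝ) * A) + 3 * (Nat.log 2 n : ℝ) * B := by ring
      _ ≤ c * (ρ ^ t * doublingWeight (k * (y - 1))) +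
          ρ ^ t * doublingWeight (2 * (k * (y - 1))) :=
        add_le_add (mul_le_mul_of_nonneg_left ih1 (norm_nonneg _)) ih2
      _ = ρ ^ t * (c * doublingWeight (k * (y - 1)) + doublingWeight (2 * (k * (y - 1)))) := by
        ring
      _ ≤ ρ ^ t * (ρ * doublingWeight (k * (y - 1))) := by gcongr
      _ = _ := by ring

lemma natCast_mul_card_eq_sum_stdAddChar [NeZero n] {ι : Type*} [Fintype ι] (X : ι → ZMod n)
    (z : ZMod n) :
    (n : ℂ) * ((univ.filter fun i => X i = z).card : ℂ) =
      ∑ k : ZMod n, ZMod.stdAddChar (-(k * z)) * ∑ i, ZMod.stdAddChar (k * X i) := by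
  simp_rw [Finset.mul_sum, ← AddChar.map_add_eq_mul]
  rw [Finset.sum_comm, Finset.card_filter, Nat.cast_sum, Finset.mul_sum]
  refine Finset.sum_congr rfl fun i _ => ?_
  have := AddChar.sum_mulShift (X i - z) (ZMod.isPrimitive_stdAddChar n)
  simp only [ZMod.card, sub_eq_zero] at this
  calc _ = ((if X i = z then n else 0 : ℕ) : ℂ) := by split_ifs <;> simp
    _ = ∑ k : ZMod n, ZMod.stdAddChar (k * (X i - z)) := by rw [this]
    _ = _ := by
      refine Finset.sum_congr rfl fun k _ => ?_
      congr 1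
      ring

lemma le_card_pollardWalk_eq [Fact n.Prime] (hodd : Odd n) (hy : y ≠ 1) {t : ℕ}
    (ht : 24 * (Nat.log 2 n : ℝ) * Real.log (8 * n / 3) ≤ t) (x z : ZMod n) :
    (3 : ℝ) ^ t / (2 * n) ≤
      ((univ.filter fun σ : Fin t → Fin 3 => pollardWalk n y x σ t = z).card : ℝ) := by
  have hn : 1 ≤ Nat.log 2 n := Nat.log_pos one_lt_two (Fact.out : n.Prime).two_le
  have hL : (1 : ℝ) ≤ Nat.log 2 n := by exact_mod_cast hn
  have hn0 : (0 : ℝ) < n := Nat.cast_pos.2 (NeZero.pos n)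
  set W := ((univ.filter fun σ : Fin t → Fin 3 => pollardWalk n y x σ t = z).card) with hW
  set L : ℝ := (Nat.log 2 n : ℝ) with hLdef
  have hdecay : (1 - 1 / (24 * L)) ^ t ≤ 3 / (8 * n) := by
    have h1 : 1 - 1 / (24 * L) ≤ Real.exp (-(1 / (24 * L))) := by
      linarith [Real.add_one_le_exp (-(1 / (24 * L)))]
    have h0 : 0 ≤ 1 - 1 / (24 * L) := by
      have : 1 / (24 * L) ≤ 1 := by rw [div_le_one (by positivity)]; linarith
      linarith
    calc (1 - 1 / (24 * L)) ^ t ≤ Real.exp (-(1 / (24 * L))) ^ t := by gcongr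
      _ = Real.exp (-(t / (24 * L))) := by rw [← Real.exp_nat_mul]; congr 1; ring
      _ ≤ Real.exp (-Real.log (8 * n / 3)) := by
        gcongr
        rw [le_div_iff₀ (by positivity)]
        linarith
      _ = 3 / (8 * n) := by rw [Real.exp_neg, Real.exp_log (by positivity), inv_div]
  have hterm : ∀ k : ZMod n, k ≠ 0 →
      ‖∑ σ : Fin t → Fin 3, ZMod.stdAddChar (k * pollardWalk n y x σ t)‖ ≤
        3 ^ t / (2 * n) := by
    intro k hk
    have h := norm_sum_stdAddChar_pollardWalk_le hodd hy x t hk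
    rw [← hLdef, mul_pow] at h
    have h' : (3 : ℝ) ^ t * (1 - 1 / (24 * L)) ^ t * doublingWeight (k * (y - 1)) ≤
        3 ^ t * (3 / (8 * n)) * (4 * L) := by
      have h0 : 0 ≤ doublingWeight (k * (y - 1)) :=
        le_trans (by positivity) (le_doublingWeight _)
      have hle := doublingWeight_le (k * (y - 1))
      gcongr
    have h2 := h.trans h'
    rw [show (3 : ℝ) ^ t * (3 / (8 * n)) * (4 * L) = 3 * L * (3 ^ t / (2 * n)) by
      field_simp; ring] at h2
    exact le_of_mul_le_mul_left h2 (by positivity)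
  have hsum := natCast_mul_card_eq_sum_stdAddChar
    (fun σ : Fin t → Fin 3 => pollardWalk n y x σ t) z
  rw [← Finset.add_sum_erase _ _ (Finset.mem_univ 0)] at hsum
  simp only [zero_mul, neg_zero, AddChar.map_zero_eq_one, one_mul, Finset.sum_const,
    Finset.card_univ, Fintype.card_fun, Fintype.card_fin, nsmul_eq_mul, mul_one] at hsum
  have herr : ‖∑ k ∈ (univ : Finset (ZMod n)).erase 0, ZMod.stdAddChar (-(k * z)) *
      ∑ σ : Fin t → Fin 3, ZMod.stdAddChar (k * pollardWalk n y x σ t)‖ ≤ 3 ^ t / 2 := by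
    calc _ ≤ ∑ k ∈ (univ : Finset (ZMod n)).erase 0, (3 : ℝ) ^ t / (2 * n) := by
          refine norm_sum_le_of_le _ fun k hk => ?_
          rw [norm_mul, AddChar.norm_apply, one_mul]
          exact hterm k (Finset.ne_of_mem_erase hk)
      _ ≤ ∑ k : ZMod n, (3 : ℝ) ^ t / (2 * n) :=
          Finset.sum_le_sum_of_subset_of_nonneg (Finset.erase_subset _ _)
            fun _ _ _ => by positivity
      _ = 3 ^ t / 2 := by
          rw [Finset.sum_const, Finset.card_univ, ZMod.card, nsmul_eq_mul]
          field_simp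
  rw [← hW] at hsum
  have hdiff : ‖((n * W - 3 ^ t : ℝ) : ℂ)‖ ≤ 3 ^ t / 2 := by
    convert herr using 2
    push_cast
    rw [hsum]
    push_cast
    ring
  rw [Complex.norm_real, Real.norm_eq_abs] at hdiff
  rw [div_le_iff₀ (by positivity)]
  linarith [(abs_le.1 hdiff).1]

lemma card_pollardWalk_notMem_le [Fact n.Prime] (hodd : Odd n) (hy : y ≠ 1) {t : ℕ}
    (ht : 24 * (Nat.log 2 n : ℝ) * Real.log (8 * n / 3) ≤ t) (S : Finset (ZMod n))
    (hS : Real.sqrt n ≤ S.card) (x : ZMod n) :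
    ((univ.filter fun σ : Fin t → Fin 3 => pollardWalk n y x σ t ∉ S).card : ℝ) ≤
      3 ^ t * (1 - 1 / (2 * Real.sqrt n)) := by
  have hn0 : (0 : ℝ) < n := Nat.cast_pos.2 (NeZero.pos n)
  have hsq : 0 < Real.sqrt n := Real.sqrt_pos.2 hn0
  have hmem : (univ.filter fun σ : Fin t → Fin 3 => pollardWalk n y x σ t ∈ S).card =
      ∑ z ∈ S, (univ.filter fun σ : Fin t → Fin 3 => pollardWalk n y x σ t = z).card := by
    rw [Finset.card_eq_sum_card_fiberwise (t := S) (f := fun σ => pollardWalk n y x σ t)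
      (fun σ hσ => by simpa using hσ)]
    refine Finset.sum_congr rfl fun z hz => ?_
    congr 1
    ext σ
    simp only [Finset.mem_filter, Finset.mem_univ, true_and]
    exact ⟨fun h => h.2, fun h => ⟨h ▸ hz, h⟩⟩
  have htotal := Finset.card_filter_add_card_filter_not
    (s := (univ : Finset (Fin t → Fin 3))) (fun σ => pollardWalk n y x σ t ∈ S)
  rw [Finset.card_univ, Fintype.card_fun, Fintype.card_fin, Fintype.card_fin] at htotal
  have hlow : (3 : ℝ) ^ t / (2 * Real.sqrt n) ≤
      ((univ.filter fun σ : Fin t → Fin 3 => pollardWalk n y x σ t ∈ S).card : ℝ) := by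
    rw [hmem, Nat.cast_sum]
    calc (3 : ℝ) ^ t / (2 * Real.sqrt n) = Real.sqrt n * (3 ^ t / (2 * n)) := by
          field_simp
          rw [Real.sq_sqrt hn0.le]
      _ ≤ S.card * (3 ^ t / (2 * n)) := by gcongr
      _ = ∑ z ∈ S, (3 : ℝ) ^ t / (2 * n) := by rw [Finset.sum_const, nsmul_eq_mul]
      _ ≤ _ := Finset.sum_le_sum fun z _ => le_card_pollardWalk_eq hodd hy ht x z
  have htotal' : ((univ.filter fun σ : Fin t → Fin 3 => pollardWalk n y x σ t ∈ S).card : ℝ) +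
      ((univ.filter fun σ : Fin t → Fin 3 => pollardWalk n y x σ t ∉ S).card : ℝ) = 3 ^ t := by
    exact_mod_cast htotal
  rw [mul_sub, mul_one, mul_one_div]
  linarith

end Mixing

section Avoidance

variable {n : ℕ} {y : ZMod n}

lemma card_filter_fin_add_le {a b : ℕ} {p : (Fin (a + b) → Fin 3) → Prop} [DecidablePred p]
    {q : (Fin a → Fin 3) → Prop} [DecidablePred q] {A c : ℝ}
    (hq : ((univ.filter q).card : ℝ) ≤ A) (hc : 0 ≤ c)
    (hpq : ∀ σ τ, p (Fin.append σ τ) → q σ)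
    (hp : ∀ σ, q σ → ((univ.filter fun τ => p (Fin.append σ τ)).card : ℝ) ≤ c) :
    ((univ.filter p).card : ℝ) ≤ A * c := by
  classical
  calc ((univ.filter p).card : ℝ)
      = ∑ σ : Fin a → Fin 3, ((univ.filter fun τ => p (Fin.append σ τ)).card : ℝ) := by
        rw [Finset.card_filter, sum_fin_add]
        push_cast
        simp only [Finset.card_filter, Nat.cast_sum, Nat.cast_ite, Nat.cast_one, Nat.cast_zero]
    _ ≤ ∑ σ : Fin a → Fin 3, if q σ then c else 0 := by
        refine Finset.sum_le_sum fun σ _ => ?_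
        split_ifs with h
        · exact hp σ h
        · rw [Finset.filter_false_of_mem fun τ _ hτ => h (hpq σ τ hτ)]
          simp
    _ = (univ.filter q).card * c := by
        rw [← Finset.sum_filter, Finset.sum_const, nsmul_eq_mul]
    _ ≤ A * c := by gcongr

lemma card_pollardWalk_avoids_le {S : Finset (ZMod n)} {t : ℕ} {c : ℝ} (hc : 0 ≤ c)
    (h : ∀ x : ZMod n,
      ((univ.filter fun σ : Fin t → Fin 3 => pollardWalk n y x σ t ∉ S).card : ℝ) ≤ c)
    (m : ℕ) (x : ZMod n) :
    ((univ.filter fun σ : Fin (m * t) → Fin 3 =>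
      ∀ j < m, pollardWalk n y x σ ((j + 1) * t) ∉ S).card : ℝ) ≤ c ^ m := by
  induction m generalizing x with
  | zero =>
    rw [pow_zero]
    refine (Nat.cast_le.2 (Finset.card_le_univ _)).trans ?_
    simp
  | succ m ih =>
    rw [pow_succ, Nat.succ_mul]
    refine card_filter_fin_add_le
      (q := fun σ => ∀ j < m, pollardWalk n y x σ ((j + 1) * t) ∉ S) (ih x) hc ?_ ?_
    · intro σ τ hp j hj
      have := hp j (by omega)
      rwa [pollardWalk_append_of_le _ _ _ (Nat.mul_le_mul_right t hj)] at this
    · intro σ _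
      refine (Nat.cast_le.2 (Finset.card_le_card ?_)).trans (h (pollardWalk n y x σ (m * t)))
      intro τ hτ
      simp only [Finset.mem_filter, Finset.mem_univ, true_and] at hτ ⊢
      have := hτ m (by omega)
      rwa [Nat.succ_mul, pollardWalk_append_add] at this

lemma card_pollardWalk_injective_le [Fact n.Prime] (hodd : Odd n) (hy : y ≠ 1) {s t : ℕ}
    (ht : 24 * (Nat.log 2 n : ℝ) * Real.log (8 * n / 3) ≤ t) (ht0 : 0 < t)
    (hs : Real.sqrt n ≤ s) (m : ℕ) (x : ZMod n) :
    ((univ.filter fun σ : Fin (s + m * t) → Fin 3 =>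
      ∀ i j : Fin (s + m * t + 1), i ≠ j →
        pollardWalk n y x σ i ≠ pollardWalk n y x σ j).card : ℝ) ≤
      3 ^ s * (3 ^ t * (1 - 1 / (2 * Real.sqrt n))) ^ m := by
  classical
  have hsq : 1 ≤ Real.sqrt n :=
    Real.one_le_sqrt.2 (by exact_mod_cast NeZero.one_le (n := n))
  have hc : 0 ≤ (3 : ℝ) ^ t * (1 - 1 / (2 * Real.sqrt n)) := by
    have : 1 / (2 * Real.sqrt n) ≤ 1 := by rw [div_le_one (by positivity)]; linarith
    exact mul_nonneg (by positivity) (by linarith)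
  refine card_filter_fin_add_le
    (q := fun σ => Set.InjOn (pollardWalk n y x σ) (Finset.range (s + 1))) ?_
    (pow_nonneg hc m) ?_ ?_
  · refine (Nat.cast_le.2 (Finset.card_le_univ _)).trans ?_
    simp
  · intro σ τ hp i hi j hj hij
    simp only [Finset.coe_range, Set.mem_Iio] at hi hj
    by_contra hne
    refine hp ⟨i, by omega⟩ ⟨j, by omega⟩ (by simpa using hne) ?_
    rwa [pollardWalk_append_of_le _ _ _ (by simp; omega),
      pollardWalk_append_of_le _ _ _ (by simp; omega)]
  · intro σ hσ
    set S := (Finset.range (s + 1)).image (pollardWalk n y x σ) with hSdef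
    have hS : Real.sqrt n ≤ S.card := by
      rw [hSdef, Finset.card_image_of_injOn hσ, Finset.card_range]
      push_cast
      linarith
    refine (Nat.cast_le.2 (Finset.card_le_card ?_)).trans
      (card_pollardWalk_avoids_le hc (card_pollardWalk_notMem_le hodd hy ht S hS) m
        (pollardWalk n y x σ s))
    intro τ hτ
    simp only [Finset.mem_filter, Finset.mem_univ, true_and] at hτ ⊢
    intro j hj hmem
    obtain ⟨i, hi, hij⟩ := Finset.mem_image.1 hmem
    rw [Finset.mem_range] at hi
    have hle : (j + 1) * t ≤ m * t := Nat.mul_le_mul_right t hj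
    have hpos : 0 < (j + 1) * t := by positivity
    refine hτ ⟨i, by omega⟩ ⟨s + (j + 1) * t, by omega⟩ ?_ ?_
    · simp only [ne_eq, Fin.mk.injEq]
      omega
    · rw [pollardWalk_append_of_le _ _ _ (by simp; omega), pollardWalk_append_add]
      exact hij

end Avoidance

lemma exists_mixing_time {n : ℕ} (hn : 3 ≤ n) :
    ∃ t : ℕ, 0 < t ∧ 24 * (Nat.log 2 n : ℝ) * Real.log (8 * n / 3) ≤ t ∧
      (t : ℝ) ≤ 100 * Real.log n ^ 3 := by
  have hn3 : (3 : ℝ) ≤ n := by exact_mod_cast hn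
  have hlog : 1 ≤ Real.log n := by
    rw [Real.le_log_iff_exp_le (by linarith)]
    linarith [Real.exp_one_lt_d9]
  have hL : 2 * (Nat.log 2 n : ℝ) ≤ 3 * Real.log n := by
    have h1 : ((2 : ℝ) ^ Nat.log 2 n) ≤ n := by
      exact_mod_cast Nat.pow_log_le_self 2 (by omega)
    have h2 := Real.log_le_log (by positivity) h1
    rw [Real.log_pow] at h2
    nlinarith [Real.log_two_gt_d9, (Nat.cast_nonneg (Nat.log 2 n) : (0 : ℝ) ≤ Nat.log 2 n)]
  have h8 : Real.log (8 * n / 3) ≤ 2 * Real.log n := by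
    rw [← Real.log_rpow (by linarith), Real.rpow_two]
    exact Real.log_le_log (by positivity) (by nlinarith)
  have h80 : 0 ≤ Real.log (8 * n / 3) := Real.log_nonneg (by linarith)
  refine ⟨⌈24 * (Nat.log 2 n : ℝ) * Real.log (8 * n / 3)⌉₊ + 1, by omega, ?_, ?_⟩
  · push_cast
    linarith [Nat.le_ceil (24 * (Nat.log 2 n : ℝ) * Real.log (8 * n / 3))]
  · have hceil := Nat.ceil_lt_add_one
      (by positivity : 0 ≤ 24 * (Nat.log 2 n : ℝ) * Real.log (8 * n / 3))
    have hprod : 24 * (Nat.log 2 n : ℝ) * Real.log (8 * n / 3) ≤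
        (36 * Real.log n) * (2 * Real.log n) :=
      mul_le_mul (by linarith) h8 h80 (by linarith)
    have h23 : Real.log n ^ 2 ≤ Real.log n ^ 3 := pow_le_pow_right₀ hlog (by norm_num)
    have h1 : 1 ≤ Real.log n ^ 3 := one_le_pow₀ hlog
    push_cast
    nlinarith

/-- **Collision time of the Pollard ρ walk (Theorem 1 of Miller–Venkatesan).**
For every `ε > 0` there is a `C > 0` such that for every odd prime `n`, every
`y ≠ 1` in `ℤ/nℤ`, every starting point `x₀` and every `N ≥ C √n (log n)³`, the
proportion of step sequences `σ ∈ (Fin 3)^N` for which the walk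
`x₀, x₁, …, x_N` has no collision is at most `ε`; equivalently the walk collides
within `N` steps with probability at least `1 - ε`. -/
theorem pollard_rho_collision :
    ∀ ε : ℝ, 0 < ε → ∃ C : ℝ, 0 < C ∧
      ∀ n : ℕ, n.Prime → Odd n → ∀ y : ZMod n, y ≠ 1 →
        ∀ x₀ : ZMod n, ∀ N : ℕ, C * Real.sqrt n * (Real.log n) ^ 3 ≤ (N : ℝ) →
          ((Finset.univ.filter
              (fun σ : Fin N → Fin 3 =>
                ∀ i j : Fin (N + 1), i ≠ j →
                  pollardWalk n y x₀ σ i ≠ pollardWalk n y x₀ σ j)).card : ℝ)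
            ≤ ε * 3 ^ N := by
  intro ε hε
  set B : ℝ := |Real.log ε| with hB
  have hB0 : 0 ≤ B := abs_nonneg _
  refine ⟨100 * (2 * B + 1) + 1, by positivity, ?_⟩
  intro n hprime hodd y hy x₀ N hN
  have : Fact n.Prime := ⟨hprime⟩
  have hn : 3 ≤ n := hprime.two_le.lt_of_ne (by rintro rfl; exact absurd hodd (by decide))
  have hn3 : (3 : ℝ) ≤ n := by exact_mod_cast hn
  have hlog : 1 ≤ Real.log n := by
    rw [Real.le_log_iff_exp_le (by linarith)]
    linarith [Real.exp_one_lt_d9]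
  have hlog3 : 1 ≤ Real.log n ^ 3 := one_le_pow₀ hlog
  have hsq : 1 ≤ Real.sqrt n := Real.one_le_sqrt.2 (by linarith)
  obtain ⟨t, ht0, ht, htle⟩ := exists_mixing_time hn
  set m : ℕ := ⌈2 * Real.sqrt n * B⌉₊ with hm
  have hm1 : 2 * Real.sqrt n * B ≤ m := Nat.le_ceil _
  have hm2 : (m : ℝ) ≤ (2 * B + 1) * Real.sqrt n := by
    have := Nat.ceil_lt_add_one (by positivity : 0 ≤ 2 * Real.sqrt n * B)
    linarith
  have hmt : (m : ℝ) * t ≤ (2 * B + 1) * Real.sqrt n * (100 * Real.log n ^ 3) := by gcongr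
  have hroom : (m : ℝ) * t + Real.sqrt n ≤ N := by
    have : Real.sqrt n ≤ Real.sqrt n * Real.log n ^ 3 :=
      le_mul_of_one_le_right (by linarith) hlog3
    linarith
  obtain ⟨s, rfl⟩ : ∃ s, N = s + m * t := by
    have : m * t ≤ N := by
      have : (m : ℝ) * t ≤ N := by linarith
      exact_mod_cast this
    exact ⟨N - m * t, by omega⟩
  have hs : Real.sqrt n ≤ s := by
    push_cast at hroom
    linarith
  refine (card_pollardWalk_injective_le hodd hy ht ht0 hs m x₀).trans ?_
  have hdecay : (1 - 1 / (2 * Real.sqrt n)) ^ m ≤ ε := by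
    have h1 : 1 - 1 / (2 * Real.sqrt n) ≤ Real.exp (-(1 / (2 * Real.sqrt n))) := by
      linarith [Real.add_one_le_exp (-(1 / (2 * Real.sqrt n)))]
    have h0 : 0 ≤ 1 - 1 / (2 * Real.sqrt n) := by
      have : 1 / (2 * Real.sqrt n) ≤ 1 := by rw [div_le_one (by positivity)]; linarith
      linarith
    calc _ ≤ Real.exp (-(1 / (2 * Real.sqrt n))) ^ m := by gcongr
      _ = Real.exp (-(m / (2 * Real.sqrt n))) := by rw [← Real.exp_nat_mul]; congr 1; ring
      _ ≤ Real.exp (Real.log ε) := by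
        gcongr
        have : B ≤ m / (2 * Real.sqrt n) := by
          rw [le_div_iff₀ (by positivity)]
          linarith
        linarith [neg_abs_le (Real.log ε)]
      _ = ε := Real.exp_log hε
  calc (3 : ℝ) ^ s * (3 ^ t * (1 - 1 / (2 * Real.sqrt n))) ^ m
      = (1 - 1 / (2 * Real.sqrt n)) ^ m * 3 ^ (s + m * t) := by
        rw [mul_pow, ← pow_mul, pow_add, mul_comm t m]
        ring
    _ ≤ ε * 3 ^ (s + m * t) := by gcongr
end
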